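/- arXiv:1806.03802 — 2 statements merged into one kernel-verified Lean document; each statement's English description precedes it below -/
import Mathlib

section
/- If K is a Kohnert diagram of D(a) for a weak composition a, then the nearest skyline diagram K↑ (obtained by repeatedly taking the first box, reading rows left to right and top to bottom, that has an empty space immediately to its left, and moving it upward within its column to the first available empty space above it, until a left-justified diagram results) is also a Kohnert diagram of D(a). -/
def skyline (a : List ℕ) : Finset (ℕ × ℕ) :=
  (Finset.range a.length).biUnion fun i =>
    (Finset.range (a.getD i 0)).image fun j => (i + 1, j + 1)
def KMove (K K' : Finset (ℕ × ℕ)) : Prop :=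
  ∃ r c r', (r, c) ∈ K ∧ (∀ c', (r, c') ∈ K → c' ≤ c) ∧
    1 ≤ r' ∧ r' < r ∧ (r', c) ∉ K ∧ (∀ s, r' < s → s < r → (s, c) ∈ K) ∧
    K' = insert (r', c) (K.erase (r, c))
def NStep (K K' : Finset (ℕ × ℕ)) : Prop :=
  ∃ r c, (r, c) ∈ K ∧ 2 ≤ c ∧ (r, c - 1) ∉ K ∧
    (∀ r₂ c₂, (r₂, c₂) ∈ K → 2 ≤ c₂ → (r₂, c₂ - 1) ∉ K → r₂ < r ∨ (r₂ = r ∧ c ≤ c₂)) ∧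
    ∃ r'', r < r'' ∧ (r'', c) ∉ K ∧ (∀ s, r < s → s < r'' → (s, c) ∈ K) ∧
      K' = insert (r'', c) (K.erase (r, c))

def IsSkyline (K : Finset (ℕ × ℕ)) : Prop :=
  ∀ p ∈ K, 2 ≤ p.2 → (p.1, p.2 - 1) ∈ K

open Relation

def NN (A : Finset ℕ) (s : ℕ) : ℕ := (A.filter (fun x => s ≤ x)).card

def Dom (A B : Finset ℕ) : Prop := A.card = B.card ∧ ∀ s, NN A s ≤ NN B s

theorem Dom.rfl' (A : Finset ℕ) : Dom A A := ⟨rfl, fun _ => le_refl _⟩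

theorem Dom.tr {A B C : Finset ℕ} (h : Dom A B) (h' : Dom B C) : Dom A C :=
  ⟨h.1.trans h'.1, fun s => (h.2 s).trans (h'.2 s)⟩

theorem NN_succ (A : Finset ℕ) (s : ℕ) : NN A s = NN A (s+1) + if s ∈ A then 1 else 0 := by
  unfold NN
  split_ifs with h
  · have : A.filter (fun x => s ≤ x) = insert s (A.filter (fun x => s+1 ≤ x)) := by
      ext x
      simp only [Finset.mem_filter, Finset.mem_insert]
      constructor
      · rintro ⟨h1, h2⟩
        rcases Nat.eq_or_lt_of_le h2 with h3 | h3
        · exact Or.inl h3.symm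
        · exact Or.inr ⟨h1, h3⟩
      · rintro (h1 | ⟨h1, h2⟩)
        · subst h1; exact ⟨h, le_refl _⟩
        · exact ⟨h1, by omega⟩
    rw [this, Finset.card_insert_of_notMem (by simp)]
  · rw [add_zero]
    congr 1
    ext x
    simp only [Finset.mem_filter]
    constructor
    · rintro ⟨h1, h2⟩
      refine ⟨h1, ?_⟩
      rcases Nat.eq_or_lt_of_le h2 with h3 | h3
      · subst h3; exact absurd h1 h
      · exact h3
    · rintro ⟨h1, h2⟩
      exact ⟨h1, by omega⟩

theorem NN_insert {A : Finset ℕ} {q : ℕ} (h : q ∉ A) (s : ℕ) :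
    NN (insert q A) s = NN A s + if s ≤ q then 1 else 0 := by
  unfold NN
  rw [Finset.filter_insert]
  split_ifs with h1
  · rw [Finset.card_insert_of_notMem (by simp [h])]
  · rfl

theorem NN_swap {E : Finset ℕ} {r q : ℕ} (hr : r ∈ E) (hq : q ∉ E) (s : ℕ) :
    NN (insert q (E.erase r)) s + (if s ≤ r then 1 else 0) = NN E s + if s ≤ q then 1 else 0 := by
  rw [NN_insert (by simp [hq])]
  have := NN_insert (Finset.notMem_erase r E) s
  rw [Finset.insert_erase hr] at this
  omega

theorem card_swap {E : Finset ℕ} {r q : ℕ} (hr : r ∈ E) (hq : q ∉ E) :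
    (insert q (E.erase r)).card = E.card := by
  rw [Finset.card_insert_of_notMem (by simp [hq]), Finset.card_erase_add_one hr]

theorem swap_le {E : Finset ℕ} {r q : ℕ} (hr : r ∈ E) (hq : q ∉ E) (h : q < r) :
    Dom (insert q (E.erase r)) E := by
  refine ⟨card_swap hr hq, fun s => ?_⟩
  have := NN_swap hr hq s
  split_ifs at this <;> omega

theorem swap_ge {E : Finset ℕ} {r q : ℕ} (hr : r ∈ E) (hq : q ∉ E) (h : r < q) :
    Dom E (insert q (E.erase r)) := by
  refine ⟨(card_swap hr hq).symm, fun s => ?_⟩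
  have := NN_swap hr hq s
  split_ifs at this <;> omega

theorem core_down {X E : Finset ℕ} {r q : ℕ} (hd : Dom X E) (hr : r ∈ E) (hX : r ∉ X)
    (hq : q ∉ E) (h : q < r) (hb : ∀ s, q < s → s < r → s ∈ E) :
    Dom X (insert q (E.erase r)) := by
  refine ⟨hd.1.trans (card_swap hr hq).symm, ?_⟩
  have key : ∀ d s, s + d = r → q < s → NN X s + 1 ≤ NN E s := by
    intro d
    induction d with
    | zero =>
      intro s hs _
      have : s = r := by omega
      subst this
      have h1 := NN_succ X s
      have h2 := NN_succ E s
      have h3 := hd.2 (s+1)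
      rw [if_neg hX] at h1
      rw [if_pos hr] at h2
      omega
    | succ d ih =>
      intro s hs hqs
      have h1 := NN_succ X s
      have h2 := NN_succ E s
      have h3 := ih (s+1) (by omega) (by omega)
      rw [if_pos (hb s hqs (by omega))] at h2
      split_ifs at h1 <;> omega
  intro s
  have h1 := NN_swap hr hq s
  have h2 := hd.2 s
  by_cases h3 : s ≤ r
  · by_cases h4 : s ≤ q
    · simp only [h3, h4, if_true] at h1; omega
    · have := key (r - s) s (by omega) (by omega)
      simp only [h3, h4, if_true, if_false] at h1; omega
  · have h4 : ¬ s ≤ q := by omega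
    simp only [h3, h4, if_false] at h1; omega

theorem core_up {Y E : Finset ℕ} {r q : ℕ} (hd : Dom E Y) (hr : r ∈ E) (hY : r ∉ Y)
    (hq : q ∉ E) (h : r < q) (hb : ∀ s, r < s → s < q → s ∈ E) :
    Dom (insert q (E.erase r)) Y := by
  refine ⟨(card_swap hr hq).trans hd.1, ?_⟩
  have key : ∀ d, r + 1 + d ≤ q → NN E (r+1+d) + 1 ≤ NN Y (r+1+d) := by
    intro d
    induction d with
    | zero =>
      intro _
      have h1 := NN_succ Y r
      have h2 := NN_succ E r
      have h3 := hd.2 r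
      rw [if_neg hY] at h1
      rw [if_pos hr] at h2
      simp only [add_zero]
      omega
    | succ d ih =>
      intro hs
      have h1 := NN_succ Y (r+1+d)
      have h2 := NN_succ E (r+1+d)
      have h3 := ih (by omega)
      rw [if_pos (hb _ (by omega) (by omega))] at h2
      rw [show r + 1 + (d+1) = r+1+d+1 by omega]
      split_ifs at h1 <;> omega
  intro s
  have h1 := NN_swap hr hq s
  have h2 := hd.2 s
  by_cases h4 : s ≤ q
  · by_cases h3 : s ≤ r
    · simp only [h3, h4, if_true] at h1; omega
    · have := key (s - (r+1)) (by omega)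
      rw [show r + 1 + (s - (r+1)) = s by omega] at this
      simp only [h3, h4, if_true, if_false] at h1; omega
  · have h3 : ¬ s ≤ r := by omega
    simp only [h3, h4, if_false] at h1; omega

def ColChain (K : Finset (ℕ × ℕ)) (k : ℕ) (T : Finset ℕ) (E : ℕ → Finset ℕ) : Prop :=
  (∀ x, (x, k) ∈ K → x ∈ E k) ∧ (∀ j, 1 ≤ j → j ≤ k → ∀ x ∈ E j, (x, j) ∈ K) ∧
  (∀ j, 1 ≤ j → j + 1 ≤ k → Dom (E (j+1)) (E j)) ∧ Dom (E 1) T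

theorem greatest_gap (E : Finset ℕ) (r' : ℕ) (h' : r' ∉ E) : ∀ r, r' < r →
    ∃ q, r' ≤ q ∧ q < r ∧ q ∉ E ∧ ∀ s, q < s → s < r → s ∈ E := by
  intro r
  induction r with
  | zero => intro h; omega
  | succ r ih =>
    intro h
    by_cases hr : r ∈ E
    · have : r' < r := by
        rcases Nat.lt_or_ge r' r with h1 | h1
        · exact h1
        · have : r = r' := by omega
          subst this; exact absurd hr h'
      obtain ⟨q, h1, h2, h3, h4⟩ := ih this
      refine ⟨q, h1, by omega, h3, fun s hs hs' => ?_⟩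
      rcases Nat.lt_or_ge s r with h5 | h5
      · exact h4 s hs h5
      · have : s = r := by omega
        subst this; exact hr
    · exact ⟨r, by omega, by omega, hr, fun s _ _ => by omega⟩

theorem least_gap (E : Finset ℕ) (r' : ℕ) (h' : r' ∉ E) (r : ℕ) (hr : r < r') :
    ∃ q, q ≤ r' ∧ r < q ∧ q ∉ E ∧ ∀ s, r < s → s < q → s ∈ E := by
  classical
  have hex : ∃ q, r < q ∧ q ∉ E := ⟨r', hr, h'⟩
  refine ⟨Nat.find hex, Nat.find_min' hex ⟨hr, h'⟩, (Nat.find_spec hex).1, (Nat.find_spec hex).2,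
    fun s hs hs' => ?_⟩
  have := Nat.find_min hex hs'
  by_contra hc
  exact this ⟨hs, hc⟩

/-- common part: replacing `r` by `q` in column `c` of the chain -/
theorem chain_update {K : Finset (ℕ × ℕ)} {k : ℕ} {T : Finset ℕ} {E : ℕ → Finset ℕ}
    (hE : ColChain K k T E) {r c p q : ℕ}
    (hr : r ∈ E c)
    (hqK : q = p ∨ (q, c) ∈ K) (hqr : q ≠ r) (hck : c = k → q = p)
    (hup : c + 1 ≤ k → Dom (E (c+1)) (insert q ((E c).erase r)))
    (hdn : ∀ j, 1 ≤ j → j + 1 = c → Dom (insert q ((E c).erase r)) (E j))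
    (hT : c = 1 → Dom (insert q ((E c).erase r)) T) :
    ColChain (insert (p, c) (K.erase (r, c))) k T
      (Function.update E c (insert q ((E c).erase r))) := by
  obtain ⟨h1, h2, h3, h4⟩ := hE
  refine ⟨?_, ?_, ?_, ?_⟩
  · intro x hx
    simp only [Finset.mem_insert, Finset.mem_erase, Prod.mk.injEq, ne_eq, not_and] at hx
    by_cases hc : k = c
    · subst hc
      rw [Function.update_self]
      have := hck rfl
      subst this
      rcases hx with hx | hx
      · simp [hx.1]
      · have hxr : x ≠ r := fun h => hx.1 h rfl
        simp [hxr, h1 x hx.2]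
    · rw [Function.update_of_ne hc]
      rcases hx with hx | hx
      · exact absurd hx.2 hc
      · exact h1 x hx.2
  · intro j hj hjk x hx
    by_cases hc : j = c
    · subst hc
      rw [Function.update_self] at hx
      simp only [Finset.mem_insert, Finset.mem_erase, Prod.mk.injEq, ne_eq, and_true] at hx ⊢
      rcases hx with hx | hx
      · subst hx
        rcases hqK with h | h
        · exact Or.inl h
        · exact Or.inr ⟨hqr, h⟩
      · exact Or.inr ⟨hx.1, h2 j hj hjk x hx.2⟩
    · rw [Function.update_of_ne hc] at hx
      have := h2 j hj hjk x hx
      simp [hc, this]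
  · intro j hj hjk
    by_cases hc : j = c
    · subst hc
      rw [Function.update_self, Function.update_of_ne (by omega)]
      exact hup hjk
    · by_cases hc' : j + 1 = c
      · have := hdn j hj hc'
        rw [Function.update_of_ne hc]
        subst hc'
        rw [Function.update_self]; exact this
      · rw [Function.update_of_ne hc, Function.update_of_ne hc']
        exact h3 j hj hjk
  · by_cases hc : 1 = c
    · have := hT hc.symm
      subst hc
      rw [Function.update_self]; exact this
    · rw [Function.update_of_ne hc]; exact h4

theorem chain_same {K : Finset (ℕ × ℕ)} {k : ℕ} {T : Finset ℕ} {E : ℕ → Finset ℕ}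
    (hE : ColChain K k T E) {r c p : ℕ} (hc : c ≠ k)
    (h : 1 ≤ c → c ≤ k → r ∉ E c) :
    ColChain (insert (p, c) (K.erase (r, c))) k T E := by
  obtain ⟨h1, h2, h3, h4⟩ := hE
  refine ⟨?_, ?_, h3, h4⟩
  · intro x hx
    simp only [Finset.mem_insert, Finset.mem_erase, Prod.mk.injEq] at hx
    rcases hx with hx | hx
    · exact absurd hx.2.symm hc
    · exact h1 x hx.2
  · intro j hj hjk x hx
    simp only [Finset.mem_insert, Finset.mem_erase, Prod.mk.injEq, ne_eq]
    refine Or.inr ⟨?_, h2 j hj hjk x hx⟩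
    rintro ⟨rfl, rfl⟩
    exact h hj hjk hx

theorem kmove_chain {K K' : Finset (ℕ × ℕ)} (hm : KMove K K') {k : ℕ} (hk : 1 ≤ k) {T : Finset ℕ}
    (hE : ∃ E, ColChain K k T E) : ∃ E, ColChain K' k T E := by
  obtain ⟨E, hE⟩ := hE
  obtain ⟨r, c, r', hrc, hmax, -, hr', hr'K, hbet, rfl⟩ := hm
  by_cases hcase : 1 ≤ c ∧ c ≤ k ∧ r ∈ E c
  · obtain ⟨hc1, hck, hr⟩ := hcase
    have hr'E : r' ∉ E c := fun h => hr'K (hE.2.1 c hc1 hck _ h)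
    obtain ⟨q, q1, q2, q3, q4⟩ := greatest_gap (E c) r' hr'E r hr'
    refine ⟨_, chain_update hE hr (q := q) ?_ (by omega) ?_ ?_ ?_ ?_⟩
    · rcases Nat.eq_or_lt_of_le q1 with h | h
      · exact Or.inl h.symm
      · exact Or.inr (hbet q h q2)
    · intro h
      subst h
      rcases Nat.eq_or_lt_of_le q1 with h | h
      · exact h.symm
      · exact absurd (hE.1 _ (hbet q h q2)) q3
    · intro h
      refine core_down (hE.2.2.1 c hc1 h) hr ?_ q3 q2 q4
      intro hX
      have := hmax _ (hE.2.1 (c+1) (by omega) h r hX)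
      omega
    · intro j hj hjc
      subst hjc
      exact (swap_le hr q3 q2).tr (hE.2.2.1 j hj hck)
    · intro h
      subst h
      exact (swap_le hr q3 q2).tr hE.2.2.2
  · refine ⟨E, chain_same hE ?_ ?_⟩
    · intro h
      subst h
      exact hcase ⟨hk, le_refl _, hE.1 _ hrc⟩
    · intro h1 h2 h3
      exact hcase ⟨h1, h2, h3⟩

theorem nstep_chain {K K' : Finset (ℕ × ℕ)} (hm : NStep K K') {k : ℕ} (hk : 1 ≤ k) {T : Finset ℕ}
    (hE : ∃ E, ColChain K k T E) : ∃ E, ColChain K' k T E := by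
  obtain ⟨E, hE⟩ := hE
  obtain ⟨r, c, hrc, hc2, hleft, -, r', hr', hr'K, hbet, rfl⟩ := hm
  by_cases hcase : 1 ≤ c ∧ c ≤ k ∧ r ∈ E c
  · obtain ⟨hc1, hck, hr⟩ := hcase
    have hr'E : r' ∉ E c := fun h => hr'K (hE.2.1 c hc1 hck _ h)
    obtain ⟨q, q1, q2, q3, q4⟩ := least_gap (E c) r' hr'E r hr'
    refine ⟨_, chain_update hE hr (q := q) ?_ (by omega) ?_ ?_ ?_ ?_⟩
    · rcases Nat.eq_or_lt_of_le q1 with h | h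
      · exact Or.inl h
      · exact Or.inr (hbet q q2 h)
    · intro h
      subst h
      rcases Nat.eq_or_lt_of_le q1 with h | h
      · exact h
      · exact absurd (hE.1 _ (hbet q q2 h)) q3
    · intro h
      exact (hE.2.2.1 c hc1 h).tr (swap_ge hr q3 q2)
    · intro j hj hjc
      subst hjc
      refine core_up (hE.2.2.1 j hj hck) hr ?_ q3 q2 q4
      intro hX
      exact hleft (hE.2.1 j hj (by omega) r hX)
    · intro h
      omega
  · refine ⟨E, chain_same hE ?_ ?_⟩
    · intro h
      subst h
      exact hcase ⟨hk, le_refl _, hE.1 _ hrc⟩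
    · intro h1 h2 h3
      exact hcase ⟨h1, h2, h3⟩

/-! Part B: the tableau criterion -/

def RowRep (K : Finset (ℕ × ℕ)) (a : ℕ → ℕ) : Prop := ∀ x y, (x, y) ∈ K ↔ 1 ≤ y ∧ y ≤ a x

theorem drop_box (c i : ℕ) (hi : 1 ≤ i) : ∀ r, ∀ K : Finset (ℕ × ℕ), i < r → (r, c) ∈ K → (i, c) ∉ K →
    (∀ c', (r, c') ∈ K → c' ≤ c) →
    (∀ s, i < s → s < r → (s, c) ∉ K → ∀ c', (s, c') ∈ K → c' ≤ c) →
    ReflTransGen KMove K (insert (i, c) (K.erase (r, c))) := by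
  intro r
  induction r using Nat.strong_induction_on with
  | _ r ih =>
    intro K hir hrK hiK hmax hbet
    set C : Finset ℕ := (K.filter (fun p => p.2 = c)).image Prod.fst with hC
    have hmem : ∀ x, x ∈ C ↔ (x, c) ∈ K := by
      intro x
      simp [hC]
    obtain ⟨q, q1, q2, q3, q4⟩ := greatest_gap C i (by rwa [hmem]) r hir
    rw [hmem] at q3
    have hstep : KMove K (insert (q, c) (K.erase (r, c))) :=
      ⟨r, c, q, hrK, hmax, by omega, q2, q3, fun s h1 h2 => (hmem s).1 (q4 s h1 h2), rfl⟩
    rcases Nat.eq_or_lt_of_le q1 with h | h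
    · subst h
      exact ReflTransGen.single hstep
    · refine ReflTransGen.head hstep ?_
      have := ih q q2 (insert (q, c) (K.erase (r, c))) h (by simp) ?_ ?_ ?_
      · have he : (insert (q, c) (K.erase (r, c))).erase (q, c) = K.erase (r, c) := by
          rw [Finset.erase_insert]
          simp [q3]
        rwa [he] at this
      · simp [hiK]; omega
      · intro c' hc'
        simp only [Finset.mem_insert, Finset.mem_erase, Prod.mk.injEq, true_and] at hc'
        rcases hc' with hc' | hc'
        · omega
        · exact hbet q h q2 q3 c' hc'.2
      · intro s h1 h2 h3 c' h4
        have e1 : ∀ y, (s, y) ∈ insert (q, c) (K.erase (r, c)) ↔ (s, y) ∈ K := by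
          intro y
          have hs1 : s ≠ q := by omega
          have hs2 : s ≠ r := by omega
          simp [hs1, hs2]
        rw [e1] at h3 h4
        exact hbet s h1 (by omega) h3 c' h4

theorem swap_reach {K : Finset (ℕ × ℕ)} {a : ℕ → ℕ} (hK : RowRep K a) {i r : ℕ} (hi : 1 ≤ i)
    (hir : i < r) (ha : a i < a r) :
    ∃ K', ReflTransGen KMove K K' ∧ RowRep K' (Function.update (Function.update a r (a i)) i (a r)) := by
  have key : ∀ d, a i + d ≤ a r → ∃ K', ReflTransGen KMove K K' ∧ ∀ x y, (x, y) ∈ K' ↔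
      (x = r ∧ 1 ≤ y ∧ y + d ≤ a r) ∨ (x = i ∧ 1 ≤ y ∧ (y ≤ a i ∨ (a r < y + d ∧ y ≤ a r))) ∨
      (x ≠ r ∧ x ≠ i ∧ 1 ≤ y ∧ y ≤ a x) := by
    intro d
    induction d with
    | zero =>
      intro _
      refine ⟨K, ReflTransGen.refl, fun x y => ?_⟩
      rw [hK]
      by_cases h1 : x = r
      · subst h1
        have : x ≠ i := by omega
        simp [this]
      · by_cases h2 : x = i
        · subst h2
          simp [h1]
        · simp [h1, h2]
    | succ d ih =>
      intro hd
      obtain ⟨K', hr, hm⟩ := ih (by omega)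
      have := drop_box (a r - d) i hi r K' hir ?_ ?_ ?_ ?_
      · refine ⟨_, hr.trans this, fun x y => ?_⟩
        simp only [Finset.mem_insert, Finset.mem_erase, Prod.mk.injEq, ne_eq, hm]
        by_cases h1 : x = r
        · subst h1
          have : x ≠ i := by omega
          simp [this]; omega
        · by_cases h2 : x = i
          · subst h2
            simp [h1]; omega
          · simp [h1, h2]
      · rw [hm]; left; omega
      · rw [hm]; omega
      · intro c' hc'
        rw [hm] at hc'
        omega
      · intro s h1 h2 h3 c' h4
        rw [hm] at h3 h4
        omega
  obtain ⟨K', h1, h2⟩ := key (a r - a i) (by omega)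
  refine ⟨K', h1, fun x y => ?_⟩
  rw [h2]
  by_cases hxi : x = i
  · subst hxi
    have : x ≠ r := by omega
    simp [this]; omega
  · by_cases hxr : x = r
    · subst hxr
      simp [hxi]; omega
    · simp [hxi, hxr]

def cnt (f : ℕ → ℕ) (c s m : ℕ) : ℕ := ((Finset.Ico s m).filter (fun x => c ≤ f x)).card

theorem cnt_top (f : ℕ → ℕ) (c s m : ℕ) (h : s ≤ m) :
    cnt f c s (m+1) = cnt f c s m + if c ≤ f m then 1 else 0 := by
  unfold cnt
  rw [← Finset.insert_Ico_right_eq_Ico_add_one h, Finset.filter_insert]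
  split_ifs with h1
  · rw [Finset.card_insert_of_notMem (by simp)]
  · rfl

theorem cnt_anti (f : ℕ → ℕ) {c c' : ℕ} (s m : ℕ) (h : c ≤ c') : cnt f c' s m ≤ cnt f c s m := by
  unfold cnt
  apply Finset.card_le_card
  intro x
  simp only [Finset.mem_filter]
  rintro ⟨h1, h2⟩
  exact ⟨h1, h.trans h2⟩

theorem cnt_congr {f g : ℕ → ℕ} {c c' s m : ℕ} (h : ∀ x, s ≤ x → x < m → (c ≤ f x ↔ c' ≤ g x)) :
    cnt f c s m = cnt g c' s m := by
  unfold cnt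
  congr 1
  ext x
  simp only [Finset.mem_filter, Finset.mem_Ico]
  constructor
  · rintro ⟨h1, h2⟩; exact ⟨h1, (h x h1.1 h1.2).1 h2⟩
  · rintro ⟨h1, h2⟩; exact ⟨h1, (h x h1.1 h1.2).2 h2⟩

theorem cnt_split (f : ℕ → ℕ) {c s t m : ℕ} (h : s ≤ t) (h' : t ≤ m) :
    cnt f c s m = cnt f c s t + cnt f c t m := by
  unfold cnt
  rw [← Finset.Ico_union_Ico_eq_Ico h h', Finset.filter_union, Finset.card_union_of_disjoint]
  exact Finset.disjoint_filter_filter (Finset.Ico_disjoint_Ico_consecutive s t m)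

theorem cnt_bot (f : ℕ → ℕ) {c s m : ℕ} (h : s < m) :
    cnt f c s m = cnt f c (s+1) m + if c ≤ f s then 1 else 0 := by
  rw [cnt_split f (t := s+1) (by omega) (by omega), cnt_top f c s s le_rfl]
  have : cnt f c s s = 0 := by simp [cnt]
  omega

/-- effect of swapping rows `i < r` -/
theorem cnt_swap (a : ℕ → ℕ) {i r s c : ℕ} (hir : i < r) :
    cnt (Function.update (Function.update a r (a i)) i (a r)) c s (r+1) =
      if s ≤ i then cnt a c s (r+1)
      else if s ≤ r then cnt a c s r + if c ≤ a i then 1 else 0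
      else 0 := by
  set a' := Function.update (Function.update a r (a i)) i (a r) with ha'
  have e1 : a' i = a r := by simp [ha']
  have e2 : a' r = a i := by
    have : r ≠ i := by omega
    simp [ha', this]
  have e3 : ∀ x, x ≠ i → x ≠ r → a' x = a x := by
    intro x h1 h2
    simp [ha', h1, h2]
  split_ifs with h1 h2 h3
  · have f1 : cnt a' c s i = cnt a c s i := cnt_congr (fun x _ _ => by rw [e3 x (by omega) (by omega)])
    have f2 : cnt a' c (i+1) r = cnt a c (i+1) r :=
      cnt_congr (fun x _ _ => by rw [e3 x (by omega) (by omega)])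
    rw [cnt_top _ _ _ _ (by omega), cnt_top _ _ _ _ (by omega), cnt_split a' h1 hir.le,
      cnt_split a h1 hir.le, cnt_bot a' hir, cnt_bot a hir, f1, f2, e1, e2]
    omega
  · rw [cnt_top _ _ _ _ h2, e2, if_pos h3]
    congr 1
    exact cnt_congr (fun x _ _ => by rw [e3 x (by omega) (by omega)])
  · rw [cnt_top _ _ _ _ h2, e2, if_neg h3]
    congr 1
    exact cnt_congr (fun x _ _ => by rw [e3 x (by omega) (by omega)])
  · unfold cnt
    rw [Finset.Ico_eq_empty (by omega)]; rfl

theorem criterion : ∀ m, ∀ (a b : ℕ → ℕ) (K S : Finset (ℕ × ℕ)), RowRep K a → RowRep S b →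
    a 0 = 0 → b 0 = 0 →
    (∀ x, m ≤ x → a x = b x) →
    (∀ c s, 1 ≤ s → cnt b c s m ≤ cnt a c s m) → (∀ c, cnt b c 1 m = cnt a c 1 m) →
    ReflTransGen KMove K S := by
  intro m
  induction m with
  | zero =>
    intro a b K S hK hS _ _ hab _ _
    have : K = S := by
      ext ⟨x, y⟩
      rw [hK, hS, hab x (by omega)]
    subst this
    exact ReflTransGen.refl
  | succ r ih =>
    intro a b K S hK hS ha0 hb0
    induction hn : a r using Nat.strong_induction_on generalizing a K with
    | _ n ih2 =>
    intro hab hle heq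
    subst hn
    by_cases hr0 : r = 0
    · subst hr0
      refine ih a b K S hK hS ha0 hb0 ?_ (fun c s hs => ?_) (fun c => ?_)
      · intro x _
        rcases Nat.eq_zero_or_pos x with h | h
        · rw [h, ha0, hb0]
        · exact hab x h
      · simp [cnt]
      · simp [cnt]
    have hr1 : 1 ≤ r := by omega
    by_cases hr : a r = b r
    · refine ih a b K S hK hS ha0 hb0 ?_ (fun c s hs => ?_) (fun c => ?_)
      · intro x hx
        rcases Nat.eq_or_lt_of_le hx with h | h
        · rw [← h, hr]
        · exact hab x h
      · by_cases hsr : s ≤ r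
        · have h1 := hle c s hs
          rw [cnt_top _ _ _ _ hsr, cnt_top _ _ _ _ hsr, hr] at h1
          omega
        · unfold cnt
          rw [Finset.Ico_eq_empty (by omega)]; rfl
      · have h1 := heq c
        rw [cnt_top _ _ _ _ hr1, cnt_top _ _ _ _ hr1, hr] at h1
        omega
    · have hlt : b r < a r := by
        have h1 := hle (b r) r hr1
        rw [cnt_top _ _ _ _ le_rfl, cnt_top _ _ _ _ le_rfl] at h1
        have h2 : cnt b (b r) r r = 0 := by simp [cnt]
        have h3 : cnt a (b r) r r = 0 := by simp [cnt]
        rw [if_pos le_rfl, h2, h3] at h1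
        split_ifs at h1 <;> omega
      -- existence
      have hex : ∃ i, 1 ≤ i ∧ i < r ∧ b r ≤ a i ∧ a i < a r := by
        by_contra hcon
        push Not at hcon
        have h1 := heq (b r)
        have h2 := heq (b r + 1)
        rw [cnt_top _ _ _ _ hr1, cnt_top _ _ _ _ hr1] at h1 h2
        have h3 : cnt a (b r) 1 r = cnt a (b r + 1) 1 r := by
          refine cnt_congr (fun x hx hx' => ?_)
          have := hcon x hx hx'
          omega
        have h4 := cnt_anti b (c := b r) (c' := b r + 1) 1 r (by omega)
        rw [if_pos (by omega), if_pos (by omega)] at h1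
        rw [if_neg (by omega), if_pos (by omega)] at h2
        omega
      obtain ⟨i0, hi0⟩ := hex
      have hmaxi : ∃ i, (1 ≤ i ∧ i < r ∧ b r ≤ a i ∧ a i < a r) ∧
          ∀ x, i < x → x < r → ¬ (b r ≤ a x ∧ a x < a r) := by
        classical
        have hs := Nat.findGreatest_spec (P := fun i => 1 ≤ i ∧ i < r ∧ b r ≤ a i ∧ a i < a r)
          (n := r) hi0.2.1.le hi0
        refine ⟨_, hs, fun x hx hx' hc => ?_⟩
        exact Nat.findGreatest_is_greatest hx hx'.le ⟨by omega, hx', hc.1, hc.2⟩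
      clear hi0
      obtain ⟨i, ⟨hi1, hir, hbi, hia⟩, hmax⟩ := hmaxi
      obtain ⟨K', hK', hrep⟩ := swap_reach hK hi1 hir hia
      refine hK'.trans ?_
      have hri : r ≠ i := by omega
      refine ih2 (a i) hia _ K' hrep ?_ ?_ ?_ ?_ ?_
      · have e1 : (0:ℕ) ≠ i := by omega
        have e2 : (0:ℕ) ≠ r := by omega
        simp [e1, e2, ha0]
      · simp [hri]
      · intro x hx
        have e1 : x ≠ i := by omega
        have e2 : x ≠ r := by omega
        simp [e1, e2, hab x hx]
      · intro c s hs
        rw [cnt_swap a hir]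
        have hb := hle c s hs
        by_cases h1 : s ≤ i
        · rw [if_pos h1]; exact hb
        · rw [if_neg h1]
          by_cases h2 : s ≤ r
          · rw [if_pos h2]
            rw [cnt_top _ _ _ _ h2, cnt_top _ _ _ _ h2] at hb
            rw [cnt_top _ _ _ _ h2]
            by_cases h3 : c ≤ a i
            · rw [if_pos (show c ≤ a r by omega)] at hb
              rw [if_pos h3]; exact hb
            · rw [if_neg h3, if_neg (show ¬ c ≤ b r by omega)]
              rw [if_neg (show ¬ c ≤ b r by omega)] at hb
              by_cases h4 : c ≤ a r
              · have h5 := hle (b r) s hs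
                rw [cnt_top _ _ _ _ h2, cnt_top _ _ _ _ h2, if_pos le_rfl, if_pos hlt.le] at h5
                have h6 := cnt_anti b (c := b r) (c' := c) s r (by omega)
                have h7 : cnt a (b r) s r = cnt a c s r := by
                  refine cnt_congr (fun x hx hx' => ?_)
                  have := hmax x (by omega) hx'
                  omega
                omega
              · rw [if_neg h4] at hb; exact hb
          · rw [if_neg h2]
            unfold cnt
            rw [Finset.Ico_eq_empty (by omega)]; simp
      · intro c
        rw [cnt_swap a hir, if_pos hi1]
        exact heq c

def Good (K : Finset (ℕ × ℕ)) : Prop := ∀ p ∈ K, 1 ≤ p.1 ∧ 1 ≤ p.2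

theorem good_move {K : Finset (ℕ × ℕ)} (h : Good K) {r c p : ℕ} (hr : (r, c) ∈ K) (hp : 1 ≤ p) :
    Good (insert (p, c) (K.erase (r, c))) := by
  intro x hx
  simp only [Finset.mem_insert, Finset.mem_erase] at hx
  rcases hx with rfl | hx
  · exact ⟨hp, (h _ hr).2⟩
  · exact h x hx.2

theorem exists_rep {S : Finset (ℕ × ℕ)} (hg : Good S) (hs : IsSkyline S) :
    ∃ b, RowRep S b ∧ b 0 = 0 := by
  have hdown : ∀ x d y, 1 ≤ y → (x, y + d) ∈ S → (x, y) ∈ S := by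
    intro x d
    induction d with
    | zero => intro y _ h; exact h
    | succ d ih =>
      intro y hy h
      have := hs _ h (by simp only; omega)
      exact ih y hy this
  refine ⟨fun x => (S.filter (fun p => p.1 = x)).sup Prod.snd, fun x y => ⟨fun h => ⟨(hg _ h).2, ?_⟩, ?_⟩, ?_⟩
  · exact Finset.le_sup (f := Prod.snd) (b := (x, y)) (by simp [h])
  · rintro ⟨h1, h2⟩
    have hne : (S.filter (fun p => p.1 = x)).Nonempty := by
      rw [Finset.nonempty_iff_ne_empty]
      intro he
      simp only [he, Finset.sup_empty] at h2
      simp at h2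
      omega
    obtain ⟨⟨u, v⟩, hp, hv⟩ := Finset.exists_mem_eq_sup _ hne Prod.snd
    simp only [Finset.mem_filter] at hp
    obtain ⟨hp, rfl⟩ := hp
    simp only at h2 hv
    rw [hv] at h2
    refine hdown u (v - y) y h1 ?_
    rwa [show y + (v - y) = v by omega]
  · have : S.filter (fun p => p.1 = 0) = ∅ := by
      ext p
      simp only [Finset.mem_filter, Finset.notMem_empty, iff_false, not_and]
      intro hp h0
      have := (hg p hp).1
      omega
    simp [this]

theorem mem_skyline (a : List ℕ) (x y : ℕ) : (x, y) ∈ skyline a ↔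
    1 ≤ x ∧ x ≤ a.length ∧ 1 ≤ y ∧ y ≤ a.getD (x-1) 0 := by
  unfold skyline
  simp only [Finset.mem_biUnion, Finset.mem_range, Finset.mem_image, Prod.mk.injEq]
  constructor
  · rintro ⟨i, hi, j, hj, rfl, rfl⟩
    rw [show i + 1 - 1 = i by omega]
    omega
  · rintro ⟨h1, h2, h3, h4⟩
    exact ⟨x - 1, by omega, y - 1, by omega, by omega, by omega⟩

def colm (K : Finset (ℕ × ℕ)) (k : ℕ) : Finset ℕ := (K.filter (fun p => p.2 = k)).image Prod.fst

theorem mem_colm (K : Finset (ℕ × ℕ)) (k x : ℕ) : x ∈ colm K k ↔ (x, k) ∈ K := by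
  simp [colm]

theorem cnt_colm {K : Finset (ℕ × ℕ)} {a : ℕ → ℕ} (hK : RowRep K a) {c s m : ℕ} (hc : 1 ≤ c)
    (hm : ∀ x, m ≤ x → a x = 0) : cnt a c s m = NN (colm K c) s := by
  unfold cnt NN
  congr 1
  ext x
  simp only [Finset.mem_filter, Finset.mem_Ico, mem_colm, hK x c]
  constructor
  · rintro ⟨h1, h2⟩; exact ⟨⟨hc, h2⟩, h1.1⟩
  · rintro ⟨⟨h1, h2⟩, h3⟩
    refine ⟨⟨h3, ?_⟩, h2⟩
    by_contra hcon
    have := hm x (by omega)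
    omega

theorem rep_bound {K : Finset (ℕ × ℕ)} {a : ℕ → ℕ} (hK : RowRep K a) {m : ℕ} (hm : K.sup Prod.fst < m) :
    ∀ x, m ≤ x → a x = 0 := by
  intro x hx
  by_contra h
  have h1 : (x, 1) ∈ K := (hK x 1).2 ⟨le_rfl, by omega⟩
  have := Finset.le_sup (f := Prod.fst) h1
  simp only at this
  omega

theorem NN_one {K : Finset (ℕ × ℕ)} (hg : Good K) (c : ℕ) : NN (colm K c) 1 = (colm K c).card := by
  unfold NN
  congr 1
  rw [Finset.filter_eq_self]
  intro x hx
  rw [mem_colm] at hx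
  exact (hg _ hx).1

theorem stmt4 (a : List ℕ) (K S : Finset (ℕ × ℕ))
    (hK : Relation.ReflTransGen KMove (skyline a) K)
    (hS : Relation.ReflTransGen NStep K S) (hsky : IsSkyline S) :
    Relation.ReflTransGen KMove (skyline a) S := by
  have hskya : IsSkyline (skyline a) := by
    rintro ⟨x, y⟩ hp hy
    simp only at hy ⊢
    rw [mem_skyline] at hp ⊢
    omega
  have hga : Good (skyline a) := by
    rintro ⟨x, y⟩ hp
    rw [mem_skyline] at hp
    exact ⟨hp.1, hp.2.2.1⟩
  obtain ⟨f, hf, hf0⟩ := exists_rep hga hskya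
  let P : Finset (ℕ × ℕ) → Prop := fun L => Good L ∧
    ∀ k, 1 ≤ k → ∃ E, ColChain L k (colm (skyline a) k) E
  have P0 : P (skyline a) := by
    refine ⟨hga, fun k hk => ⟨fun _ => colm (skyline a) k, ?_, ?_, ?_, ?_⟩⟩
    · intro x hx; rwa [mem_colm]
    · intro j hj hjk x hx
      rw [mem_colm, hf] at hx
      rw [hf]; omega
    · intro j _ _; exact Dom.rfl' _
    · exact Dom.rfl' _
  have PK : P K := by
    clear hS
    induction hK with
    | refl => exact P0
    | tail _ hm ih =>
      refine ⟨?_, fun k hk => kmove_chain hm hk (ih.2 k hk)⟩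
      obtain ⟨r, c, r', h1, -, h2, -, -, -, rfl⟩ := hm
      exact good_move ih.1 h1 h2
  have PS : P S := by
    clear hsky
    induction hS with
    | refl => exact PK
    | tail _ hm ih =>
      refine ⟨?_, fun k hk => nstep_chain hm hk (ih.2 k hk)⟩
      obtain ⟨r, c, h1, -, -, -, r', h2, -, -, rfl⟩ := hm
      exact good_move ih.1 h1 (by omega)
  obtain ⟨hgS, hch⟩ := PS
  obtain ⟨b, hb, hb0⟩ := exists_rep hgS hsky
  have hdom : ∀ k, 1 ≤ k → Dom (colm S k) (colm (skyline a) k) := by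
    intro k hk
    obtain ⟨E, h1, h2, h3, h4⟩ := hch k hk
    have e : colm S k = E k := by
      ext x
      rw [mem_colm]
      exact ⟨h1 x, h2 k hk le_rfl x⟩
    rw [e]
    have : ∀ d, 1 + d ≤ k → Dom (E (1+d)) (E 1) := by
      intro d
      induction d with
      | zero => intro _; exact Dom.rfl' _
      | succ d ih =>
        intro h
        exact (h3 (1+d) (by omega) (by omega)).tr (ih (by omega))
    have := this (k-1) (by omega)
    rw [show 1 + (k-1) = k by omega] at this
    exact this.tr h4
  set m := max ((skyline a).sup Prod.fst) (S.sup Prod.fst) + 1 with hm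
  have ba := rep_bound hf (m := m) (by omega)
  have bb := rep_bound hb (m := m) (by omega)
  refine criterion m f b _ _ hf hb hf0 hb0 (fun x hx => by rw [ba x hx, bb x hx]) ?_ ?_
  · intro c s _
    rcases Nat.eq_zero_or_pos c with h | h
    · subst h; simp [cnt]
    · rw [cnt_colm hf h ba, cnt_colm hb h bb]
      exact (hdom c h).2 s
  · intro c
    rcases Nat.eq_zero_or_pos c with h | h
    · subst h; simp [cnt]
    · rw [cnt_colm hf h ba, cnt_colm hb h bb, NN_one hgS, NN_one hga]
      exact (hdom c h).1
end

section
/- For any weak composition a, the Lascoux polynomial decomposes as D̄_a = Σ_b Ā_b, where the sum is over all weak compositions b with sort(b) = sort(a) and w(b) ≤ w(a) in strong Bruhat order; equivalently, the sum is over all b ∈ lswap(a). -/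
def Dominates (b a : List ℕ) : Prop :=
  b.length = a.length ∧ ∀ i : ℕ, (a.take i).sum ≤ (b.take i).sum

def posPart (a : List ℕ) : List ℕ := a.filter (fun v => v != 0)
abbrev SVF : Type := ℕ → ℕ → Finset ℕ

def shapeLen (b : List ℕ) (i : ℕ) : ℕ := b.getD (i - 1) 0

def SBox (b : List ℕ) (i j : ℕ) : Prop :=
  1 ≤ i ∧ i ≤ b.length ∧ 1 ≤ j ∧ j ≤ shapeLen b i

def anc (F : SVF) (i j : ℕ) : ℕ := (F i j).sup id

noncomputable def infv (F : SVF) (i j : ℕ) : ℕ := sInf (F i j : Set ℕ)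

def InvTriple (be al ga : ℕ) : Prop := (ga < al ∧ al ≤ be) ∨ (al ≤ be ∧ be < ga)

def RowOK (b : List ℕ) (F : SVF) (i j v : ℕ) : Prop :=
  (j = 1 ∨ v ≤ infv F i (j - 1)) ∧ (¬ SBox b i (j + 1) ∨ anc F i (j + 1) ≤ v)

def SVSSF (b : List ℕ) (F : SVF) : Prop :=
  (∀ i j, (F i j).Nonempty ↔ SBox b i j) ∧
  (∀ i j v, v ∈ F i j → 0 < v) ∧
  (∀ j i i', i ≠ i' → ∀ v, v ∈ F i j → v ∉ F i' j) ∧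
  (∀ i j, SBox b i j → SBox b i (j + 1) → anc F i (j + 1) ≤ infv F i j) ∧
  (∀ i i' j, i < i' → SBox b i j → SBox b i (j + 1) → SBox b i' (j + 1) →
      shapeLen b i' ≤ shapeLen b i → InvTriple (anc F i j) (anc F i (j + 1)) (anc F i' (j + 1))) ∧
  (∀ i i' j, i < i' → SBox b i' j → SBox b i' (j + 1) → SBox b i j →
      shapeLen b i < shapeLen b i' → InvTriple (anc F i' j) (anc F i' (j + 1)) (anc F i j)) ∧
  (∀ i j v, SBox b i j → v ∈ F i j → v ≠ anc F i j →
      ∀ i', SBox b i' j → anc F i' j < anc F i j → v < anc F i' j → ¬ RowOK b F i' j v)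

def LASSF (b : List ℕ) (F : SVF) : Prop :=
  SVSSF b F ∧ ∀ i, SBox b i 1 → anc F i 1 = i

def wtF (b : List ℕ) (F : SVF) (v : ℕ) : ℕ :=
  ((skyline b).filter fun p => v ∈ F p.1 p.2).card

def sizeF (b : List ℕ) (F : SVF) : ℕ := ∑ p ∈ skyline b, (F p.1 p.2).card
noncomputable def vmono (w : ℕ → ℕ) : MvPolynomial ℕ (Polynomial ℤ) :=
  ∏ᶠ v, MvPolynomial.X v ^ w v

noncomputable def atomPoly (b : List ℕ) : MvPolynomial ℕ (Polynomial ℤ) :=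
  ∑ᶠ F ∈ {F : SVF | LASSF b F},
    MvPolynomial.C (Polynomial.X ^ (sizeF b F - b.sum)) * vmono (wtF b F)

noncomputable def quasiLascoux (a : List ℕ) : MvPolynomial ℕ (Polynomial ℤ) :=
  ∑ᶠ b ∈ {b : List ℕ | Dominates b a ∧ posPart b = posPart a}, atomPoly b
def BBox (a : List ℕ) (i j : ℕ) : Prop :=
  (1 ≤ i ∧ i ≤ a.length ∧ j = 0) ∨ SBox a.reverse i j

def RowOKB (a : List ℕ) (F : SVF) (i j v : ℕ) : Prop :=
  v ≤ infv F i (j - 1) ∧ (¬ BBox a i (j + 1) ∨ anc F i (j + 1) ≤ v)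

def LSSF (a : List ℕ) (F : SVF) : Prop :=
  (∀ i j, (F i j).Nonempty ↔ BBox a i j) ∧
  (∀ i, 1 ≤ i → i ≤ a.length → F i 0 = {a.length - i + 1}) ∧
  (∀ i j v, v ∈ F i j → 0 < v) ∧
  (∀ j i i', i ≠ i' → ∀ v, v ∈ F i j → v ∉ F i' j) ∧
  (∀ i j, BBox a i j → BBox a i (j + 1) → anc F i (j + 1) ≤ infv F i j) ∧
  (∀ i i' j, i < i' → BBox a i j → BBox a i (j + 1) → BBox a i' (j + 1) →
      shapeLen a.reverse i' ≤ shapeLen a.reverse i →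
      InvTriple (anc F i j) (anc F i (j + 1)) (anc F i' (j + 1))) ∧
  (∀ i i' j, i < i' → BBox a i' j → BBox a i' (j + 1) → BBox a i j →
      shapeLen a.reverse i < shapeLen a.reverse i' →
      InvTriple (anc F i' j) (anc F i' (j + 1)) (anc F i j)) ∧
  (∀ i j v, BBox a i j → 1 ≤ j → v ∈ F i j → v ≠ anc F i j →
      ∀ i', BBox a i' j → anc F i' j < anc F i j → v < anc F i' j → ¬ RowOKB a F i' j v)

noncomputable def lascouxPoly (a : List ℕ) : MvPolynomial ℕ (Polynomial ℤ) :=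
  ∑ᶠ F ∈ {F : SVF | LSSF a F},
    MvPolynomial.C (Polynomial.X ^ (sizeF a.reverse F - a.sum)) * vmono (wtF a.reverse F)
def LSwapStep (a b : List ℕ) : Prop :=
  ∃ i j, i < j ∧ j < a.length ∧ a.getD i 0 ≤ a.getD j 0 ∧
    b = (a.set i (a.getD j 0)).set j (a.getD i 0)


structure Fil (n : ℕ) (f : ℕ → ℕ → ℕ) : Prop where
  base : ∀ v, 1 ≤ v → v ≤ n → f v 0 = v
  out : ∀ v j, ¬ (1 ≤ v ∧ v ≤ n) → f v j = 0
  anti : ∀ v j, f v (j + 1) ≤ f v j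
  inj : ∀ j u v, u ≠ v → 0 < f u j → f u j ≠ f v j

def Shp (n : ℕ) (f : ℕ → ℕ → ℕ) (a : List ℕ) : Prop :=
  a.length = n ∧ ∀ v, 1 ≤ v → v ≤ n → ∀ j, 0 < f v j ↔ j ≤ shapeLen a v

def Col (f g : ℕ → ℕ → ℕ) : Prop :=
  ∀ j t, 0 < t → ((∃ v, f v j = t) ↔ ∃ v, g v j = t)

def AtC (f : ℕ → ℕ → ℕ) : Prop :=
  ∀ u v j, u < v → ¬ (f u (j + 1) < f v (j + 1) ∧ f v (j + 1) ≤ f u j)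

def LC (f : ℕ → ℕ → ℕ) : Prop :=
  ∀ u v j, u < v → ¬ (0 < f v j ∧ f u (j + 1) ≤ f v j ∧ f v j < f u j)

theorem Col.refl (f : ℕ → ℕ → ℕ) : Col f f := fun _ _ _ => Iff.rfl
theorem Col.symm {f g : ℕ → ℕ → ℕ} (h : Col f g) : Col g f := fun j t ht => (h j t ht).symm
theorem Col.trans {f g h : ℕ → ℕ → ℕ} (h1 : Col f g) (h2 : Col g h) : Col f h :=
  fun j t ht => (h1 j t ht).trans (h2 j t ht)

open Classical in
noncomputable def opx (f : ℕ → ℕ → ℕ) (p q : ℕ) (P : ℕ → Prop) : ℕ → ℕ → ℕ := fun k j =>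
  if P j then (if k = p then max (f p j) (f q j) else if k = q then min (f p j) (f q j) else f k j)
  else f k j

theorem Fil.le {n : ℕ} {f : ℕ → ℕ → ℕ} (h : Fil n f) (v j : ℕ) : f v j ≤ n := by
  by_cases hv : 1 ≤ v ∧ v ≤ n
  · induction j with
    | zero => rw [h.base v hv.1 hv.2]; exact hv.2
    | succ j ih => exact (h.anti v j).trans ih
  · rw [h.out v j hv]; exact Nat.zero_le _

theorem opx_fil {n : ℕ} {f : ℕ → ℕ → ℕ} (h : Fil n f) {p q : ℕ} {P : ℕ → Prop}
    (hp : 1 ≤ p ∧ p ≤ n) (hq : 1 ≤ q ∧ q ≤ n) (hpq : p ≠ q)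
    (h0 : P 0 → q ≤ p) (hP : ∀ j, ¬ (P j ↔ P (j + 1)) → f q (j + 1) ≤ f p j) :
    Fil n (opx f p q P) := by
  refine ⟨?_, ?_, ?_, ?_⟩
  · intro v h1 h2
    have e1 := h.base v h1 h2
    have e2 := h.base p hp.1 hp.2
    have e3 := h.base q hq.1 hq.2
    unfold opx
    split_ifs with c1 c2 c3
    · have := h0 c1; subst c2; rw [e2, e3]; omega
    · have := h0 c1; subst c3; rw [e2, e3]; omega
    · exact e1
    · exact e1
  · intro v j hv
    have e1 := h.out v j hv
    unfold opx
    split_ifs with c1 c2 c3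
    · exact absurd hp (c2 ▸ hv)
    · exact absurd hq (c3 ▸ hv)
    · exact e1
    · exact e1
  · intro v j
    have e1 := h.anti v j
    have e2 := h.anti p j
    have e3 := h.anti q j
    have e4 := hP j
    by_cases c1 : P j <;> by_cases c2 : P (j + 1) <;> by_cases c3 : v = p <;>
      by_cases c4 : v = q <;> simp [opx, c1, c2, c3, c4, hpq, hpq.symm] at * <;> omega
  · intro j u v huv
    have e1 := h.inj j u v huv
    have e2 := h.inj j p q hpq
    have e3 := h.inj j q p hpq.symm
    have e4 := h.inj j u p
    have e5 := h.inj j u q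
    have e6 := h.inj j v p
    have e7 := h.inj j v q
    have e8 := h.inj j p v
    have e9 := h.inj j q v
    unfold opx
    split_ifs <;> grind

theorem opx_col {f : ℕ → ℕ → ℕ} {p q : ℕ} (P : ℕ → Prop) (hpq : p ≠ q) :
    Col f (opx f p q P) := by
  intro j t ht
  have key : ∀ k, opx f p q P k j = f k j ∨ (k = p ∨ k = q) := by
    intro k; unfold opx; grind
  have k2 : (opx f p q P p j = f p j ∧ opx f p q P q j = f q j) ∨
     (opx f p q P p j = f q j ∧ opx f p q P q j = f p j) := by
    unfold opx; grind
  constructor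
  · rintro ⟨v, hv⟩
    by_cases h1 : v = p
    · subst h1; rcases k2 with k2 | k2
      · exact ⟨v, by omega⟩
      · exact ⟨q, by omega⟩
    · by_cases h2 : v = q
      · subst h2; rcases k2 with k2 | k2
        · exact ⟨v, by omega⟩
        · exact ⟨p, by omega⟩
      · rcases key v with k | k
        · exact ⟨v, by omega⟩
        · tauto
  · rintro ⟨v, hv⟩
    by_cases h1 : v = p
    · subst h1; rcases k2 with k2 | k2
      · exact ⟨v, by omega⟩
      · exact ⟨q, by omega⟩
    · by_cases h2 : v = q
      · subst h2; rcases k2 with k2 | k2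
        · exact ⟨v, by omega⟩
        · exact ⟨p, by omega⟩
      · rcases key v with k | k
        · exact ⟨v, by omega⟩
        · tauto

def Phi (n N : ℕ) (w : ℕ → ℕ) (f : ℕ → ℕ → ℕ) : ℕ :=
  ∑ j ∈ Finset.range N, ∑ k ∈ Finset.Icc 1 n, w k * f k j

theorem Phi_le {n N : ℕ} {w : ℕ → ℕ} {f : ℕ → ℕ → ℕ} (h : Fil n f) (hw : ∀ k, k ≤ n → w k ≤ n) :
    Phi n N w f ≤ N * (n * (n * n)) := by
  unfold Phi
  calc _ ≤ ∑ j ∈ Finset.range N, ∑ k ∈ Finset.Icc 1 n, n * n := by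
        refine Finset.sum_le_sum fun j _ => Finset.sum_le_sum fun k hk => ?_
        exact Nat.mul_le_mul (hw k (Finset.mem_Icc.1 hk).2) (h.le k j)
    _ = _ := by simp

theorem Phi_lt {n N : ℕ} {w : ℕ → ℕ} {f : ℕ → ℕ → ℕ} {p q : ℕ} {P : ℕ → Prop}
    (hp : 1 ≤ p ∧ p ≤ n) (hq : 1 ≤ q ∧ q ≤ n) (hpq : p ≠ q) (hw : w q < w p)
    {j0 : ℕ} (hj : j0 < N) (hPj : P j0) (hlt : f p j0 < f q j0) :
    Phi n N w f < Phi n N w (opx f p q P) := by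
  have split : ∀ (g : ℕ → ℕ), ∑ k ∈ Finset.Icc 1 n, g k =
      g p + (g q + ∑ k ∈ ((Finset.Icc 1 n).erase p).erase q, g k) := by
    intro g
    rw [Finset.add_sum_erase _ _ (by simp [hpq.symm]; exact hq),
      Finset.add_sum_erase _ _ (by simp; exact hp)]
  have same : ∀ j, ∑ k ∈ ((Finset.Icc 1 n).erase p).erase q, w k * opx f p q P k j =
      ∑ k ∈ ((Finset.Icc 1 n).erase p).erase q, w k * f k j := by
    intro j
    refine Finset.sum_congr rfl fun k hk => ?_
    simp only [Finset.mem_erase] at hk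
    simp [opx, hk.1, hk.2.1]
  unfold Phi
  refine Finset.sum_lt_sum ?_ ⟨j0, Finset.mem_range.2 hj, ?_⟩
  · intro j _
    rw [split, split, same]
    simp only [opx, hpq.symm, if_true, if_false]
    split_ifs
    · rcases le_total (f p j) (f q j) with h | h
      · rw [max_eq_right h, min_eq_left h]
        nlinarith
      · rw [max_eq_left h, min_eq_right h]
    · exact le_rfl
  · rw [split, split, same]
    simp only [opx, hpq.symm, if_true, if_false, hPj]
    rw [max_eq_right hlt.le, min_eq_left hlt.le]
    nlinarith

theorem shp_zero {n : ℕ} {f : ℕ → ℕ → ℕ} {a : List ℕ} (h : Fil n f) (hs : Shp n f a) {v j : ℕ}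
    (hv : 0 < f v j) : (1 ≤ v ∧ v ≤ n) ∧ j ≤ shapeLen a v := by
  by_cases c : 1 ≤ v ∧ v ≤ n
  · exact ⟨c, (hs.2 v c.1 c.2 j).1 hv⟩
  · rw [h.out v j c] at hv; omega

theorem shapeLen_le (a : List ℕ) (v : ℕ) : shapeLen a v ≤ a.sum := by
  unfold shapeLen
  by_cases h : v - 1 < a.length
  · rw [List.getD_eq_getElem _ _ h]
    exact List.single_le_sum (by simp) _ (List.getElem_mem h)
  · rw [List.getD_eq_default _ _ (by omega)]; omega

theorem step_perm {a b : List ℕ} (h : LSwapStep a b) : b.Perm a := by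
  obtain ⟨i, j, hij, hj, hle, rfl⟩ := h
  rw [List.getD_eq_getElem _ _ hj, List.getD_eq_getElem _ _ (hij.trans hj)]
  exact List.set_set_perm (by omega) hj

theorem lswap_perm {a b : List ℕ} (h : Relation.ReflTransGen LSwapStep a b) : b.Perm a := by
  induction h with
  | refl => exact List.Perm.refl _
  | tail _ h ih => exact (step_perm h).trans ih

theorem shapeLen_swap {a : List ℕ} {i j : ℕ} (hij : i < j) (hj : j < a.length) (v : ℕ) (hv : 1 ≤ v) :
    shapeLen ((a.set i (a.getD j 0)).set j (a.getD i 0)) v =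
      if v = j + 1 then a.getD i 0 else if v = i + 1 then a.getD j 0 else shapeLen a v := by
  unfold shapeLen
  simp only [List.getD_eq_getElem?_getD, List.getElem?_set, List.length_set]
  by_cases h1 : v = j + 1
  · subst h1; simp [hj]
  · by_cases h2 : v = i + 1
    · subst h2; have : i < a.length := by omega
      have h3 : ¬ j = i := by omega
      simp [this, h3]
      intro h; omega
    · have h3 : ¬ j = v - 1 := by omega
      have h4 : ¬ i = v - 1 := by omega
      simp [h1, h2, h3, h4]

/-- upward closure -/
theorem beta_step {n : ℕ} {a b : List ℕ} (hab : LSwapStep a b) {f : ℕ → ℕ → ℕ} (hf : Fil n f)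
    (hs : Shp n f b) : ∃ g, Fil n g ∧ Shp n g a ∧ Col f g := by
  have hlen := (step_perm hab).length_eq
  obtain ⟨i, j, hij, hj, hle, rfl⟩ := hab
  have hn : a.length = n := by rw [← hlen]; exact hs.1
  refine ⟨opx f (j + 1) (i + 1) (fun _ => True), ?_, ⟨hn, ?_⟩, ?_⟩
  · exact opx_fil hf (by omega) (by omega) (by omega) (fun _ => by omega) (by simp)
  · intro v h1 h2 k
    have key := fun v (hv : 1 ≤ v) => shapeLen_swap hij hj v hv
    have e1 := hs.2 (j + 1) (by omega) (by omega) k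
    have e2 := hs.2 (i + 1) (by omega) (by omega) k
    have e3 := hs.2 v h1 h2 k
    rw [key _ (by omega)] at e1 e2 e3
    have s1 : shapeLen a (j + 1) = a.getD j 0 := rfl
    have s2 : shapeLen a (i + 1) = a.getD i 0 := rfl
    simp only [opx, if_true]
    by_cases c1 : v = j + 1
    · subst c1
      rw [if_pos rfl, s1]
      rw [if_pos rfl] at e1
      rw [if_neg (by omega), if_pos rfl] at e2
      rw [lt_max_iff, e1, e2]; omega
    · by_cases c2 : v = i + 1
      · subst c2
        rw [if_neg c1, if_pos rfl, s2]
        rw [if_pos rfl] at e1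
        rw [if_neg (by omega), if_pos rfl] at e2
        rw [lt_min_iff, e1, e2]; omega
      · rw [if_neg c1, if_neg c2]
        rw [if_neg c1, if_neg c2] at e3
        exact e3
  · exact opx_col _ (by omega)

theorem beta {n : ℕ} {a b : List ℕ} (hab : Relation.ReflTransGen LSwapStep a b) {f : ℕ → ℕ → ℕ}
    (hf : Fil n f) (hs : Shp n f b) : ∃ g, Fil n g ∧ Shp n g a ∧ Col f g := by
  induction hab using Relation.ReflTransGen.head_induction_on with
  | refl => exact ⟨f, hf, hs, Col.refl f⟩
  | head h _ ih =>
    obtain ⟨g, h1, h2, h3⟩ := ih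
    obtain ⟨g', h1', h2', h3'⟩ := beta_step h h1 h2
    exact ⟨g', h1', h2', h3.trans h3'⟩

theorem alpha {n : ℕ} {a : List ℕ} : ∀ (m : ℕ) {f : ℕ → ℕ → ℕ} (_ : Fil n f) (_ : Shp n f a)
    (_ : (a.sum + 1) * (n * (n * n)) - Phi n (a.sum + 1) (fun k => k) f = m),
    ∃ g, Fil n g ∧ Shp n g a ∧ Col f g ∧ LC g := by
  intro m
  induction m using Nat.strong_induction_on with
  | _ m ih =>
  intro f hf hs hm
  by_cases hL : LC f
  · exact ⟨f, hf, hs, Col.refl f, hL⟩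
  · unfold LC at hL
    push Not at hL
    obtain ⟨u, v, j, huv, h1, h2, h3⟩ := hL
    have hv := shp_zero hf hs h1
    have hu := shp_zero hf hs (h1.trans h3)
    have hne : v ≠ u := by omega
    have hf' : Fil n (opx f v u (fun i => i ≤ j)) := by
      refine opx_fil hf hv.1 hu.1 hne (fun _ => huv.le) ?_
      intro i hi
      have : i = j := by by_contra hc; exact hi (by omega)
      subst this; exact h2
    have hs' : Shp n (opx f v u (fun i => i ≤ j)) a := by
      refine ⟨hs.1, fun k hk1 hk2 i => ?_⟩
      have e0 := hs.2 k hk1 hk2 i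
      have e1 := hs.2 u hu.1.1 hu.1.2 i
      have e2 := hs.2 v hv.1.1 hv.1.2 i
      have h4 := hu.2
      have h5 := hv.2
      unfold opx
      split_ifs with c1 c2 c3
      · subst c2; rw [lt_max_iff, e1, e2]; omega
      · subst c3; rw [lt_min_iff, e1, e2]; omega
      · exact e0
      · exact e0
    have hcol : Col f (opx f v u (fun i => i ≤ j)) := opx_col _ hne
    have hlt : Phi n (a.sum + 1) (fun k => k) f <
        Phi n (a.sum + 1) (fun k => k) (opx f v u (fun i => i ≤ j)) :=
      Phi_lt hv.1 hu.1 hne huv (j0 := j) (by have := shapeLen_le a v; omega) le_rfl h3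
    have hle := Phi_le (N := a.sum + 1) (w := fun k => k) hf' (fun k hk => hk)
    obtain ⟨g, g1, g2, g3, g4⟩ := ih _ (by omega) hf' hs' rfl
    exact ⟨g, g1, g2, hcol.trans g3, g4⟩

theorem gamma {n : ℕ} {s : ℕ} : ∀ (m : ℕ) {a : List ℕ} {f : ℕ → ℕ → ℕ} (_ : a.sum = s)
    (_ : Fil n f) (_ : Shp n f a)
    (_ : (s + 1) * (n * (n * n)) - Phi n (s + 1) (fun k => n - k) f = m),
    ∃ g b, Relation.ReflTransGen LSwapStep a b ∧ Fil n g ∧ Shp n g b ∧ Col f g ∧ AtC g := by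
  intro m
  induction m using Nat.strong_induction_on with
  | _ m ih =>
  intro a f ha hf hs hm
  by_cases hL : AtC f
  · exact ⟨f, a, .refl, hf, hs, Col.refl f, hL⟩
  · unfold AtC at hL
    push Not at hL
    obtain ⟨u, v, j, huv, h1, h2⟩ := hL
    have hv := shp_zero hf hs (Nat.zero_lt_of_lt h1)
    have hu := shp_zero hf hs (lt_of_lt_of_le (Nat.zero_lt_of_lt h1) h2)
    have hne : u ≠ v := by omega
    have hf' : Fil n (opx f u v (fun i => j < i)) := by
      refine opx_fil hf hu.1 hv.1 hne (fun h => by omega) ?_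
      intro i hi
      have : i = j := by by_contra hc; exact hi (by omega)
      subst this; exact h2
    have hcol : Col f (opx f u v (fun i => j < i)) := opx_col _ hne
    have hlt : Phi n (s + 1) (fun k => n - k) f <
        Phi n (s + 1) (fun k => n - k) (opx f u v (fun i => j < i)) :=
      Phi_lt hu.1 hv.1 hne (by show n - v < n - u; omega) (j0 := j + 1)
        (by have := shapeLen_le a v; omega) (by simp) h1
    have hle := Phi_le (N := s + 1) (w := fun k => n - k) hf' (fun k hk => by simp)
    have hs' : ∃ a', Relation.ReflTransGen LSwapStep a a' ∧
        Shp n (opx f u v (fun i => j < i)) a' := by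
      have h4 := hu.2
      have h5 := hv.2
      by_cases hc : shapeLen a u ≤ shapeLen a v
      · have hn := hs.1
        have hst : LSwapStep a ((a.set (u - 1) (a.getD (v - 1) 0)).set (v - 1) (a.getD (u - 1) 0)) :=
          ⟨u - 1, v - 1, by omega, by omega, hc, rfl⟩
        refine ⟨_, .single hst, (step_perm hst).length_eq.trans hn, fun k hk1 hk2 i => ?_⟩
        have e0 := hs.2 k hk1 hk2 i
        have e1 := hs.2 u hu.1.1 hu.1.2 i
        have e2 := hs.2 v hv.1.1 hv.1.2 i
        rw [shapeLen_swap (by omega) (by omega) k hk1]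
        have s1 : shapeLen a v = a.getD (v - 1) 0 := rfl
        have s2 : shapeLen a u = a.getD (u - 1) 0 := rfl
        rw [← s1, ← s2]
        have u1 : u - 1 + 1 = u := by omega
        have v1 : v - 1 + 1 = v := by omega
        rw [u1, v1]
        unfold opx
        by_cases c2 : k = u
        · subst c2
          simp only [if_true, hne, if_false]
          split_ifs with c1
          · rw [lt_max_iff, e1, e2]; omega
          · rw [e1]; omega
        · by_cases c3 : k = v
          · subst c3
            simp only [if_true, c2, if_false]
            split_ifs with c1
            · rw [lt_min_iff, e1, e2]; omega
            · rw [e2]; omega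
          · simp only [c2, c3, if_false, ite_self]; exact e0
      · refine ⟨a, .refl, hs.1, fun k hk1 hk2 i => ?_⟩
        have e0 := hs.2 k hk1 hk2 i
        have e1 := hs.2 u hu.1.1 hu.1.2 i
        have e2 := hs.2 v hv.1.1 hv.1.2 i
        unfold opx
        split_ifs with c1 c2 c3
        · subst c2; rw [lt_max_iff, e1, e2]; omega
        · subst c3; rw [lt_min_iff, e1, e2]; omega
        · exact e0
        · exact e0
    obtain ⟨a', ha', hs'⟩ := hs'
    obtain ⟨g, b, g0, g1, g2, g3, g4⟩ := ih _ (by omega)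
      ((lswap_perm ha').sum_eq.trans ha) hf' hs' rfl
    exact ⟨g, b, ha'.trans g0, g1, g2, hcol.trans g3, g4⟩

/-- uniqueness for LC -/
theorem LC_unique {n : ℕ} {a : List ℕ} {f g : ℕ → ℕ → ℕ} (hf : Fil n f) (hg : Fil n g)
    (sf : Shp n f a) (sg : Shp n g a) (hc : Col f g) (lf : LC f) (lg : LC g) : f = g := by
  have pos : ∀ v j, 0 < f v j ↔ 0 < g v j := by
    intro v j
    by_cases hv : 1 ≤ v ∧ v ≤ n
    · rw [sf.2 v hv.1 hv.2, sg.2 v hv.1 hv.2]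
    · rw [hf.out v j hv, hg.out v j hv]
  have step : ∀ j, (∀ v, f v (j + 1) = g v (j + 1)) → ∀ t v, f v j = t ∨ g v j = t → f v j = g v j := by
    intro j hj t
    induction t using Nat.strong_induction_on with
    | _ t ih =>
    intro r hpt
    by_contra hne
    have hpos : 0 < t := by
      rcases hpt with h | h
      · have := pos r j; omega
      · have := pos r j; omega
    -- both rows
    obtain ⟨p, q, hp, hq⟩ : ∃ p q, f p j = t ∧ g q j = t := by
      rcases hpt with h | h
      · obtain ⟨q, hq⟩ := (hc j t hpos).1 ⟨r, h⟩; exact ⟨r, q, h, hq⟩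
      · obtain ⟨q, hq⟩ := (hc j t hpos).2 ⟨r, h⟩; exact ⟨q, r, hq, h⟩
    by_cases hpq : p = q
    · subst hpq
      rcases hpt with h | h
      · by_cases hr : r = p
        · subst hr; omega
        · exact hf.inj j r p hr (by omega) (by omega)
      · by_cases hr : r = p
        · subst hr; omega
        · exact hg.inj j r p hr (by omega) (by omega)
    · have h1 : f q j > t := by
        have := hf.inj j p q hpq (by omega)
        by_contra hlt
        have := ih (f q j) (by omega) q (Or.inl rfl)
        omega
      have h2 : g p j > t := by
        have := hg.inj j q p (Ne.symm hpq) (by omega)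
        by_contra hlt
        have := ih (g p j) (by omega) p (Or.inr rfl)
        omega
      have a1 := hf.anti p j
      have a2 := hg.anti q j
      have a3 := hj p
      have a4 := hj q
      rcases lt_or_gt_of_ne hpq with h | h
      · exact lg p q j h ⟨by omega, by omega, by omega⟩
      · exact lf q p j h ⟨by omega, by omega, by omega⟩
  have main : ∀ d j, j + d = a.sum + 1 → ∀ v, f v j = g v j := by
    intro d
    induction d with
    | zero =>
      intro j hj v
      have := pos v j
      have h1 : f v j = 0 := by
        by_contra hc
        have := shp_zero hf sf (v := v) (j := j) (by omega)
        have := shapeLen_le a v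
        omega
      omega
    | succ d ih =>
      intro j hj v
      exact step j (ih (j + 1) (by omega)) _ v (Or.inl rfl)
  funext v j
  by_cases hj : j ≤ a.sum + 1
  · exact main (a.sum + 1 - j) j (by omega) v
  · have := pos v j
    have h1 : f v j = 0 := by
      by_contra hc
      have := shp_zero hf sf (v := v) (j := j) (by omega)
      have := shapeLen_le a v
      omega
    omega

theorem AtC_unique {n : ℕ} {f g : ℕ → ℕ → ℕ} (hf : Fil n f) (hg : Fil n g)
    (hc : Col f g) (lf : AtC f) (lg : AtC g) : f = g := by
  have step : ∀ j, (∀ v, f v j = g v j) → ∀ d v, n - f v (j + 1) = d ∨ n - g v (j + 1) = d →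
      f v (j + 1) = g v (j + 1) := by
    intro j hj d
    induction d using Nat.strong_induction_on with
    | _ d ih =>
    intro r hrt
    by_contra hne
    have b1 := hf.le
    have b2 := hg.le
    by_cases hd : d = n
    · rcases hrt with h | h
      · have h0 : f r (j + 1) = 0 := by have := b1 r (j + 1); omega
        have := ih (n - g r (j + 1)) (by have := b2 r (j + 1); omega) r (Or.inr rfl)
        omega
      · have h0 : g r (j + 1) = 0 := by have := b2 r (j + 1); omega
        have := ih (n - f r (j + 1)) (by have := b1 r (j + 1); omega) r (Or.inl rfl)
        omega
    have hdn : d < n := by omega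
    obtain ⟨p, q, hp, hq⟩ : ∃ p q, f p (j + 1) = n - d ∧ g q (j + 1) = n - d := by
      rcases hrt with h | h
      · have e : f r (j + 1) = n - d := by have := b1 r (j + 1); omega
        obtain ⟨q, hq⟩ := (hc (j + 1) (n - d) (by omega)).1 ⟨r, e⟩; exact ⟨r, q, e, hq⟩
      · have e : g r (j + 1) = n - d := by have := b2 r (j + 1); omega
        obtain ⟨q, hq⟩ := (hc (j + 1) (n - d) (by omega)).2 ⟨r, e⟩; exact ⟨q, r, hq, e⟩
    by_cases hpq : p = q
    · subst hpq
      have b3 := b1 r (j + 1)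
      have b4 := b2 r (j + 1)
      rcases hrt with h | h
      · by_cases hr : r = p
        · subst hr; omega
        · exact hf.inj (j + 1) r p hr (by omega) (by omega)
      · by_cases hr : r = p
        · subst hr; omega
        · exact hg.inj (j + 1) r p hr (by omega) (by omega)
    · have h1 : f q (j + 1) < n - d := by
        have := hf.inj (j + 1) p q hpq (by omega)
        by_contra hlt
        have := ih (n - f q (j + 1)) (by have := b1 q (j + 1); omega) q (Or.inl rfl)
        omega
      have h2 : g p (j + 1) < n - d := by
        have := hg.inj (j + 1) q p (Ne.symm hpq) (by omega)
        by_contra hlt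
        have := ih (n - g p (j + 1)) (by have := b2 p (j + 1); omega) p (Or.inr rfl)
        omega
      have a1 := hf.anti p j
      have a2 := hg.anti q j
      have a3 := hj p
      have a4 := hj q
      rcases lt_or_gt_of_ne hpq with h | h
      · exact lg p q j h ⟨by omega, by omega⟩
      · exact lf q p j h ⟨by omega, by omega⟩
  funext v j
  induction j generalizing v with
  | zero =>
    by_cases hv : 1 ≤ v ∧ v ≤ n
    · rw [hf.base v hv.1 hv.2, hg.base v hv.1 hv.2]
    · rw [hf.out v _ hv, hg.out v _ hv]
  | succ j ih => exact step j ih _ v (Or.inl rfl)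

structure SV (n : ℕ) (H : SVF) : Prop where
  out : ∀ v j, ¬ (1 ≤ v ∧ v ≤ n) → H v j = ∅
  base : ∀ v, 1 ≤ v → v ≤ n → H v 0 = {v}
  pos : ∀ v j e, e ∈ H v j → 0 < e
  disj : ∀ j u v, u ≠ v → ∀ e, e ∈ H u j → e ∉ H v j
  row : ∀ v j e, e ∈ H v j → anc H v (j + 1) ≤ e
  nest : ∀ v j, H v j = ∅ → H v (j + 1) = ∅
  minim : ∀ v j e, e ∈ H v j → e ≠ anc H v j → ∀ v', anc H v' j < anc H v j →
    e < anc H v' j → e < anc H v' (j + 1)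

theorem le_anc {H : SVF} {v j e : ℕ} (h : e ∈ H v j) : e ≤ anc H v j :=
  Finset.le_sup (f := id) h

theorem anc_empty {H : SVF} {v j : ℕ} (h : H v j = ∅) : anc H v j = 0 := by
  simp [anc, h]

theorem anc_mem {H : SVF} {v j : ℕ} (h : (H v j).Nonempty) : anc H v j ∈ H v j := by
  obtain ⟨e, he, h2⟩ := Finset.exists_mem_eq_sup (H v j) h id
  unfold anc; rw [h2]; exact he

theorem anc_mem' {H : SVF} {v j : ℕ} (h : 0 < anc H v j) : anc H v j ∈ H v j := by
  apply anc_mem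
  by_contra hc
  rw [Finset.not_nonempty_iff_eq_empty] at hc
  rw [anc_empty hc] at h; omega

theorem SV.anc_pos {n : ℕ} {H : SVF} (h : SV n H) {v j : ℕ} : 0 < anc H v j ↔ (H v j).Nonempty :=
  ⟨fun h => ⟨_, anc_mem' h⟩, fun h' => h.pos v j _ (anc_mem h')⟩

theorem SV.fil {n : ℕ} {H : SVF} (h : SV n H) : Fil n (anc H) := by
  refine ⟨?_, ?_, ?_, ?_⟩
  · intro v h1 h2; simp [anc, h.base v h1 h2]
  · intro v j hv; exact anc_empty (h.out v j hv)
  · intro v j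
    rcases (H v j).eq_empty_or_nonempty with hc | hc
    · rw [anc_empty (h.nest v j hc)]; omega
    · exact h.row v j _ (anc_mem hc)
  · intro j u v huv h0 heq
    have h1 := anc_mem' h0
    have h2 := anc_mem' (heq ▸ h0 : 0 < anc H v j)
    rw [heq] at h1
    exact h.disj j u v huv _ h1 h2

/-- same entries in each column -/
def CS (H K : SVF) : Prop := ∀ j e, (∃ v, e ∈ H v j) ↔ ∃ v, e ∈ K v j

theorem SV_unique {n : ℕ} {H K : SVF} (hH : SV n H) (hK : SV n K) (ha : anc H = anc K)
    (hc : CS H K) : H = K := by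
  have sub : ∀ {H K : SVF}, SV n H → SV n K → anc H = anc K → CS H K → ∀ v j e, e ∈ H v j →
      e ∈ K v j := by
    intro H K hH hK ha hc v j e he
    have hpos : 0 < anc H v j := hH.anc_pos.2 ⟨e, he⟩
    by_cases hea : e = anc H v j
    · rw [hea, ha]; exact anc_mem' (ha ▸ hpos)
    · obtain ⟨w, hw⟩ := (hc j e).1 ⟨v, he⟩
      have hposw : 0 < anc K w j := hK.anc_pos.2 ⟨e, hw⟩
      have hew : e ≠ anc K w j := by
        intro h
        have h2 : e ∈ H w j := by rw [h, ← ha]; exact anc_mem' (by rw [ha]; exact hposw)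
        by_cases hvw : v = w
        · subst hvw; rw [ha] at hea; exact hea h
        · exact hH.disj j v w hvw e he h2
      have l1 := le_anc he
      have l2 := le_anc hw
      have r1 := hH.row v j e he
      have r2 := hK.row w j e hw
      have m1 := hH.minim v j e he hea w
      have m2 := hK.minim w j e hw hew v
      rw [ha] at l1 r1 m1 hea hpos
      have heq : anc K v j = anc K w j := by omega
      have : v = w := by
        by_contra hvw
        exact hK.fil.inj j v w hvw hpos heq
      subst this; exact hw
  funext v j
  ext e
  exact ⟨sub hH hK ha hc v j e, sub hK hH ha.symm (fun j e => (hc j e).symm) v j e⟩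

theorem card_gt {n : ℕ} {f g : ℕ → ℕ → ℕ} (hf : Fil n f) (hg : Fil n g) (hc : Col f g) (j e : ℕ) :
    ((Finset.Icc 1 n).filter (fun v => e < f v j)).card =
      ((Finset.Icc 1 n).filter (fun v => e < g v j)).card := by
  have key : ∀ f, Fil n f → ((Finset.Icc 1 n).filter (fun v => e < f v j)).card =
      (((Finset.Icc 1 n).filter (fun v => e < f v j)).image (fun v => f v j)).card := by
    intro f hf
    rw [Finset.card_image_of_injOn]
    intro u hu v hv huv
    simp only [Finset.coe_filter, Set.mem_ofPred_eq] at hu hv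
    by_contra hne
    exact hf.inj j u v hne (by omega) huv
  have sub : ∀ f g, Fil n f → Fil n g → Col f g →
      (((Finset.Icc 1 n).filter (fun v => e < f v j)).image (fun v => f v j)) ⊆
      (((Finset.Icc 1 n).filter (fun v => e < g v j)).image (fun v => g v j)) := by
    intro f g hf hg hc t ht
    simp only [Finset.mem_image, Finset.mem_filter, Finset.mem_Icc] at ht ⊢
    obtain ⟨v, ⟨h1, h2⟩, h3⟩ := ht
    obtain ⟨w, hw⟩ := (hc j t (by omega)).1 ⟨v, h3⟩
    refine ⟨w, ⟨?_, by omega⟩, hw⟩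
    by_contra hcon
    have := hg.out w j hcon
    omega
  rw [key f hf, key g hg]
  exact congrArg _ (Finset.Subset.antisymm (sub f g hf hg hc) (sub g f hg hf hc.symm))

theorem free_place {n : ℕ} {f g : ℕ → ℕ → ℕ} (hf : Fil n f) (hg : Fil n g) (hc : Col f g)
    {j e v : ℕ} (h1 : f v (j + 1) ≤ e) (h2 : e < f v j) : ∃ w, g w (j + 1) ≤ e ∧ e < g w j := by
  by_contra hcon
  push Not at hcon
  have e1 := card_gt hf hg hc j e
  have e2 := card_gt hf hg hc (j + 1) e
  have l1 : ((Finset.Icc 1 n).filter (fun v => e < f v (j + 1))).card <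
      ((Finset.Icc 1 n).filter (fun v => e < f v j)).card := by
    apply Finset.card_lt_card
    refine ⟨?_, ?_⟩
    · intro w hw
      simp only [Finset.mem_filter] at hw ⊢
      exact ⟨hw.1, lt_of_lt_of_le hw.2 (hf.anti w j)⟩
    · intro hs
      have hv : v ∈ (Finset.Icc 1 n).filter (fun v => e < f v j) := by
        simp only [Finset.mem_filter, Finset.mem_Icc]
        refine ⟨?_, h2⟩
        by_contra hc
        have := hf.out v j hc
        omega
      have := hs hv
      simp only [Finset.mem_filter] at this
      omega
  have l2 : ((Finset.Icc 1 n).filter (fun v => e < g v j)).card ≤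
      ((Finset.Icc 1 n).filter (fun v => e < g v (j + 1))).card := by
    apply Finset.card_le_card
    intro w hw
    simp only [Finset.mem_filter] at hw ⊢
    refine ⟨hw.1, ?_⟩
    by_contra hc
    have := hcon w (by omega)
    omega
  omega

theorem SV_exists {n : ℕ} {H : SVF} (hH : SV n H) {g : ℕ → ℕ → ℕ} (hg : Fil n g)
    (hc : Col (anc H) g) : ∃ K, SV n K ∧ anc K = g ∧ CS H K := by
  classical
  have hf := hH.fil
  -- free entries
  let Q : ℕ → ℕ → ℕ → Prop := fun v j e =>
    (0 < e ∧ e = g v j) ∨ ((∃ w, e ∈ H w j) ∧ (∀ w, g w j ≠ e) ∧ g v (j + 1) ≤ e ∧ e < g v j ∧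
      ∀ w, e < g w j → g w (j + 1) ≤ e → g v j ≤ g w j)
  let K : SVF := fun v j => (Finset.range (n + 1)).filter (fun e => Q v j e)
  have hpe : ∀ {w j e}, e ∈ H w j → 0 < e := fun h => hH.pos _ _ _ h
  have hle : ∀ {v j e}, Q v j e → e ≤ g v j := by
    intro v j e h
    rcases h with h | h
    · exact h.2.le
    · exact h.2.2.2.1.le
  have memK : ∀ v j e, e ∈ K v j ↔ Q v j e := by
    intro v j e
    simp only [K, Finset.mem_filter, Finset.mem_range]
    refine ⟨fun h => h.2, fun h => ⟨?_, h⟩⟩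
    have := hle h; have := hg.le v j; omega
  have ancK : ∀ v j, anc K v j = g v j := by
    intro v j
    apply le_antisymm
    · apply Finset.sup_le
      intro e he
      exact hle ((memK v j e).1 he)
    · rcases Nat.eq_zero_or_pos (g v j) with h | h
      · omega
      · exact le_anc ((memK v j _).2 (Or.inl ⟨h, rfl⟩))
  refine ⟨K, ⟨?_, ?_, ?_, ?_, ?_, ?_, ?_⟩, by funext v j; exact ancK v j, ?_⟩
  · intro v j hv
    rw [Finset.eq_empty_iff_forall_notMem]
    intro e he
    have := (memK v j e).1 he
    have h0 := hg.out v j hv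
    rcases this with h | h
    · omega
    · omega
  · intro v h1 h2
    ext e
    rw [memK, Finset.mem_singleton]
    have h0 := hg.base v h1 h2
    constructor
    · rintro (h | h)
      · omega
      · obtain ⟨⟨w, hw⟩, h4, h5⟩ := h
        by_cases hw' : 1 ≤ w ∧ w ≤ n
        · rw [hH.base w hw'.1 hw'.2, Finset.mem_singleton] at hw
          exact absurd (by rw [hg.base w hw'.1 hw'.2, hw]) (h4 w)
        · rw [hH.out w 0 hw'] at hw; simp at hw
    · rintro rfl; left; omega
  · intro v j e he
    rcases (memK v j e).1 he with h | h
    · exact h.1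
    · obtain ⟨⟨w, hw⟩, _⟩ := h; exact hpe hw
  · intro j u v huv e h1 h2
    have h1 := (memK _ _ _).1 h1
    have h2 := (memK _ _ _).1 h2
    rcases h1 with h1 | h1 <;> rcases h2 with h2 | h2
    · exact hg.inj j u v huv (by omega) (by omega)
    · exact h2.2.1 u h1.2.symm
    · exact h1.2.1 v h2.2.symm
    · have := h1.2.2.2.2 v h2.2.2.2.1 h2.2.2.1
      have := h2.2.2.2.2 u h1.2.2.2.1 h1.2.2.1
      exact hg.inj j u v huv (by omega) (by omega)
  · intro v j e he
    rw [ancK]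
    have := hg.anti v j
    rcases (memK v j e).1 he with h | h
    · omega
    · exact h.2.2.1
  · intro v j he
    rw [Finset.eq_empty_iff_forall_notMem]
    intro e h
    have h1 := hle ((memK _ _ _).1 h)
    have h2 := hg.anti v j
    have h3 := anc_empty he
    rw [ancK] at h3
    rcases (memK _ _ _).1 h with h | h
    · omega
    · omega
  · intro v j e he hne v' h1 h2
    rw [ancK] at hne h1 h2 ⊢
    rw [ancK] at h1
    rcases (memK _ _ _).1 he with h | h
    · omega
    · by_contra hcon
      have := h.2.2.2.2 v' h2 (by omega)
      omega
  · intro j e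
    constructor
    · rintro ⟨v, hv⟩
      by_cases hA : ∃ w, g w j = e
      · obtain ⟨w, hw⟩ := hA
        exact ⟨w, (memK _ _ _).2 (Or.inl ⟨hpe hv, hw.symm⟩)⟩
      · have hne : e ≠ anc H v j := fun h => hA ((hc j e (hpe hv)).1 ⟨v, h.symm⟩)
        have hlt : e < anc H v j := lt_of_le_of_ne (le_anc hv) hne
        obtain ⟨w0, hw0⟩ := free_place hf hg hc (hH.row v j e hv) hlt
        have hex : ∃ m, ∃ w, (g w (j + 1) ≤ e ∧ e < g w j) ∧ g w j = m := ⟨_, w0, hw0, rfl⟩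
        obtain ⟨w, hw, hm⟩ := Nat.find_spec hex
        refine ⟨w, (memK _ _ _).2 (Or.inr ⟨⟨v, hv⟩, fun w h => hA ⟨w, h⟩, hw.1, hw.2, ?_⟩)⟩
        intro w' h1 h2
        rw [hm]
        exact Nat.find_min' hex ⟨w', ⟨h2, h1⟩, rfl⟩
    · rintro ⟨v, hv⟩
      rcases (memK _ _ _).1 hv with h | h
      · obtain ⟨w, hw⟩ := (hc j e h.1).2 ⟨v, h.2.symm⟩
        exact ⟨w, by rw [← hw]; exact anc_mem' (by rw [hw]; exact h.1)⟩
      · exact h.1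

theorem infv_le {F : SVF} {i j e : ℕ} (h : e ∈ F i j) : infv F i j ≤ e :=
  Nat.sInf_le (Finset.mem_coe.2 h)

theorem le_infv {F : SVF} {i j x : ℕ} (hne : (F i j).Nonempty) (h : ∀ e ∈ F i j, x ≤ e) :
    x ≤ infv F i j :=
  h _ (Finset.mem_coe.1 (Nat.sInf_mem (s := (F i j : Set ℕ)) (by exact_mod_cast hne)))

def extF (n : ℕ) (F : SVF) : SVF := fun v j =>
  if j = 0 then (if 1 ≤ v ∧ v ≤ n then {v} else ∅) else F v j

def unextF (K : SVF) : SVF := fun v j => if j = 0 then ∅ else K v j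

theorem extF_pos (n : ℕ) (F : SVF) (v : ℕ) {j : ℕ} (hj : 1 ≤ j) : extF n F v j = F v j := by
  unfold extF; rw [if_neg (by omega)]

theorem anc_extF_pos (n : ℕ) (F : SVF) (v : ℕ) {j : ℕ} (hj : 1 ≤ j) :
    anc (extF n F) v j = anc F v j := by
  unfold anc; rw [extF_pos n F v hj]

theorem anc_extF_zero {n : ℕ} (F : SVF) {v : ℕ} (hv : 1 ≤ v ∧ v ≤ n) :
    anc (extF n F) v 0 = v := by
  simp [anc, extF, hv]

theorem lassf_to {b : List ℕ} {F : SVF} (h : LASSF b F) :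
    SV b.length (extF b.length F) ∧ Shp b.length (anc (extF b.length F)) b ∧
      AtC (anc (extF b.length F)) := by
  obtain ⟨⟨hne, hpos, hdisj, hrow, hA, hB, hfree⟩, hbase⟩ := h
  have hSB : ∀ {i j e}, e ∈ F i j → SBox b i j := fun h => (hne _ _).1 ⟨_, h⟩
  have hanc : ∀ {i j}, 0 < anc F i j ↔ SBox b i j := by
    intro i j
    exact ⟨fun h => (hne i j).1 ⟨_, anc_mem' h⟩,
      fun h => hpos i j _ (anc_mem ((hne i j).2 h))⟩
  have hsb : ∀ {i j}, 1 ≤ j → SBox b i (j + 1) → SBox b i j := by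
    rintro i j hj ⟨h1, h2, h3, h4⟩; exact ⟨h1, h2, hj, by omega⟩
  have sv : SV b.length (extF b.length F) := by
    refine ⟨?_, ?_, ?_, ?_, ?_, ?_, ?_⟩
    · intro v j hv
      unfold extF
      split_ifs
      · rfl
      · rw [← Finset.not_nonempty_iff_eq_empty, hne]
        rintro ⟨h1, h2, _⟩; exact hv ⟨h1, h2⟩
    · intro v h1 h2; simp [extF, h1, h2]
    · intro v j e he
      unfold extF at he
      split_ifs at he with c1 c2
      · rw [Finset.mem_singleton] at he; omega
      · simp at he
      · exact hpos v j e he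
    · intro j u v huv e h1 h2
      unfold extF at h1 h2
      split_ifs at h1 h2
      · rw [Finset.mem_singleton] at h1 h2; omega
      all_goals first | exact hdisj j u v huv e h1 h2 | (simp at h1; done) | (simp at h2; done)
    · intro v j e he
      rw [anc_extF_pos _ _ _ (by omega)]
      by_contra hc
      have hs : SBox b v (j + 1) := hanc.1 (by omega)
      unfold extF at he
      split_ifs at he with c1 c2
      · rw [Finset.mem_singleton] at he
        subst c1
        have := hbase v hs
        simp at hc
        omega
      · simp at he
      · have := hrow v j (hSB he) hs
        have := infv_le he
        omega
    · intro v j he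
      rw [extF_pos _ _ _ (by omega)]
      rw [← Finset.not_nonempty_iff_eq_empty, hne]
      intro hs
      unfold extF at he
      split_ifs at he with c1 c2
      · simp at he
      · exact c2 ⟨hs.1, hs.2.1⟩
      · have := (hne v j).2 (hsb (by omega) hs)
        rw [he] at this; simp at this
    · intro v j e he hea v' h1 h2
      rcases Nat.eq_zero_or_pos j with rfl | hj
      · exfalso
        unfold extF at he
        split_ifs at he with c1 c2
        · rw [Finset.mem_singleton] at he
          rw [anc_extF_zero F c2] at hea; exact hea he
        · simp at he
        · omega
      · rw [anc_extF_pos _ _ _ hj] at hea h2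
        rw [anc_extF_pos _ _ _ hj, anc_extF_pos _ _ _ hj] at h1
        rw [extF_pos _ _ _ hj] at he
        rw [anc_extF_pos _ _ _ (by omega)]
        by_contra hc
        have hs' : SBox b v' j := hanc.1 (by omega)
        refine hfree v j e (hSB he) he hea v' hs' h1 h2 ⟨?_, Or.inr (by omega)⟩
        by_cases hj1 : j = 1
        · exact Or.inl hj1
        · right
          obtain ⟨k, rfl⟩ : ∃ k, j = k + 1 := ⟨j - 1, by omega⟩
          have := hrow v' k (hsb (by omega) hs') hs'
          simp; omega
  have shp : Shp b.length (anc (extF b.length F)) b := by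
    refine ⟨rfl, fun v h1 h2 j => ?_⟩
    rcases Nat.eq_zero_or_pos j with rfl | hj
    · rw [anc_extF_zero F ⟨h1, h2⟩]; omega
    · rw [anc_extF_pos _ _ _ hj, hanc]
      exact ⟨fun h => h.2.2.2, fun h => ⟨h1, h2, hj, h⟩⟩
  refine ⟨sv, shp, ?_⟩
  intro u v j huv ⟨h1, h2⟩
  have hv := shp_zero sv.fil shp (Nat.zero_lt_of_lt h1)
  have hu := shp_zero sv.fil shp (lt_of_lt_of_le (Nat.zero_lt_of_lt h1) h2)
  have sbv : SBox b v (j + 1) := ⟨hv.1.1, hv.1.2, by omega, hv.2⟩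
  rcases Nat.eq_zero_or_pos j with rfl | hj
  · rw [anc_extF_pos _ _ _ (by omega)] at h2
    rw [anc_extF_zero F hu.1] at h2
    have := hbase v sbv
    simp at h2
    omega
  · rw [anc_extF_pos _ _ _ (by omega), anc_extF_pos _ _ _ (by omega)] at h1
    rw [anc_extF_pos _ _ _ (by omega), anc_extF_pos _ _ _ (by omega)] at h2
    have h3 := hu.2
    have h4 := hv.2
    by_cases hc : shapeLen b v ≤ shapeLen b u
    · have := hA u v j huv ⟨hu.1.1, hu.1.2, hj, h3⟩ ⟨hu.1.1, hu.1.2, by omega, by omega⟩ sbv hc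
      unfold InvTriple at this
      omega
    · have key : ∀ i, 1 ≤ i → i ≤ shapeLen b u → anc F u i < anc F v (i + 1) := by
        intro i hi
        have tri : i ≤ shapeLen b u → anc F u i < anc F v i → anc F u i < anc F v (i + 1) := by
          intro hiu hlt
          have := hB u v i huv ⟨hv.1.1, hv.1.2, hi, by omega⟩ ⟨hv.1.1, hv.1.2, by omega, by omega⟩
            ⟨hu.1.1, hu.1.2, hi, hiu⟩ (by omega)
          unfold InvTriple at this
          omega
        induction i, hi using Nat.le_induction with
        | base =>
          intro hiu
          apply tri hiu
          rw [hbase u ⟨hu.1.1, hu.1.2, by omega, by omega⟩,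
            hbase v ⟨hv.1.1, hv.1.2, by omega, by omega⟩]
          exact huv
        | succ i hi ih =>
          intro hiu
          apply tri hiu
          have h5 := ih (by
            intro hiu hlt
            have := hB u v i huv ⟨hv.1.1, hv.1.2, hi, by omega⟩
              ⟨hv.1.1, hv.1.2, by omega, by omega⟩ ⟨hu.1.1, hu.1.2, hi, hiu⟩ (by omega)
            unfold InvTriple at this
            omega) (by omega)
          have h6 := sv.fil.anti u i
          rw [anc_extF_pos _ _ _ (by omega), anc_extF_pos _ _ _ hi] at h6
          omega
      have := key j hj h3
      omega

theorem lassf_of {b : List ℕ} {K : SVF} (sv : SV b.length K) (shp : Shp b.length (anc K) b)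
    (hat : AtC (anc K)) : LASSF b (unextF K) := by
  have hf := sv.fil
  have hpos : ∀ {i j}, 1 ≤ j → unextF K i j = K i j := by
    intro i j hj; unfold unextF; rw [if_neg (by omega)]
  have hap : ∀ {i j}, 1 ≤ j → anc (unextF K) i j = anc K i j := by
    intro i j hj; unfold anc; rw [hpos hj]
  have hS : ∀ {i j}, SBox b i j ↔ 1 ≤ j ∧ 0 < anc K i j := by
    intro i j
    constructor
    · rintro ⟨h1, h2, h3, h4⟩
      exact ⟨h3, (shp.2 i h1 h2 j).2 h4⟩
    · rintro ⟨h1, h2⟩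
      have := shp_zero hf shp h2
      exact ⟨this.1.1, this.1.2, h1, this.2⟩
  have hne : ∀ i j, (unextF K i j).Nonempty ↔ SBox b i j := by
    intro i j
    rw [hS]
    rcases Nat.eq_zero_or_pos j with rfl | hj
    · simp [unextF]
    · rw [hpos hj, sv.anc_pos]
      exact ⟨fun h => ⟨hj, h⟩, fun h => h.2⟩
  have hj1 : ∀ {i j e}, e ∈ unextF K i j → 1 ≤ j ∧ e ∈ K i j := by
    intro i j e h
    unfold unextF at h
    split_ifs at h with c
    · simp at h
    · exact ⟨by omega, h⟩
  refine ⟨⟨hne, ?_, ?_, ?_, ?_, ?_, ?_⟩, ?_⟩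
  · intro i j v h; exact sv.pos _ _ _ (hj1 h).2
  · intro j i i' hi v h1 h2; exact sv.disj j i i' hi v (hj1 h1).2 (hj1 h2).2
  · intro i j h1 h2
    apply le_infv ((hne i j).2 h1)
    intro e he
    rw [hap (by omega)]
    exact sv.row i j e (hj1 he).2
  · intro u v j huv h1 h2 h3 hlen
    rw [hap h1.2.2.1, hap (by omega), hap (by omega)]
    have a1 := hat u v j huv
    have a2 := hf.anti u j
    have a3 := hf.inj (j + 1) u v (by omega) (hS.1 h2).2
    unfold InvTriple
    omega
  · intro u v j huv h1 h2 h3 hlen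
    rw [hap h1.2.2.1, hap (by omega), hap h1.2.2.1]
    have a2 := hf.anti v j
    have key : ∀ d i, i + d = shapeLen b u → anc K u i < anc K v (i + 1) := by
      intro d
      induction d with
      | zero =>
        intro i hi
        have e1 := shp.2 u h3.1 h3.2.1 (i + 1)
        have e2 := shp.2 v h1.1 h1.2.1 (i + 1)
        have a1 := hat u v i huv
        omega
      | succ d ih =>
        intro i hi
        have e1 := ih (i + 1) (by omega)
        have e2 := hf.anti v (i + 1)
        have a1 := hat u v i huv
        omega
    have := key (shapeLen b u - j) j (by have := h3.2.2.2; omega)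
    unfold InvTriple
    omega
  · intro i j v hs hv hne' i' hs' h1 h2 hR
    have hj := hs.2.2.1
    rw [hap hj] at hne' h2
    rw [hap hj, hap hj] at h1
    have m := sv.minim i j v (hj1 hv).2 hne' i' h1 h2
    rcases hR.2 with h | h
    · apply h; rw [hS]; exact ⟨by omega, by omega⟩
    · rw [hap (by omega)] at h; omega
  · intro i hs
    rw [hap le_rfl]
    have a1 := hf.anti i 0
    have a2 := hf.base i hs.1 hs.2.1
    have a3 := (hS.1 hs).2
    by_contra hc
    have b1 : 1 ≤ anc K i 1 := a3
    have b2 : anc K i 1 < i := by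
      have : anc K i (0 + 1) = anc K i 1 := rfl
      omega
    have b3 := hs.2.1
    have b4 := hf.base (anc K i 1) b1 (by omega)
    have b5 := hf.anti (anc K i 1) 0
    have b6 := hf.inj 1 i (anc K i 1) (by omega) a3
    have b7 := hat (anc K i 1) i 0 b2
    simp only [Nat.zero_add] at b5 b7
    omega

def revF (n : ℕ) (F : SVF) : SVF := fun v j => F (n + 1 - v) j

theorem shapeLen_rev (a : List ℕ) {v : ℕ} (h1 : 1 ≤ v) (h2 : v ≤ a.length) :
    shapeLen a.reverse (a.length + 1 - v) = shapeLen a v := by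
  unfold shapeLen
  rw [List.getD_reverse _ (by omega)]
  congr 1
  omega

theorem revF_revF {n : ℕ} {F : SVF} (h : ∀ v j, ¬ (1 ≤ v ∧ v ≤ n) → F v j = ∅) :
    revF n (revF n F) = F := by
  funext v j
  unfold revF
  by_cases hv : v ≤ n + 1
  · congr 1; omega
  · rw [h v j (by omega), h _ j (by omega)]

theorem anc_revF (n : ℕ) (F : SVF) (v j : ℕ) : anc (revF n F) v j = anc F (n + 1 - v) j := rfl

theorem lssf_to {a : List ℕ} {F : SVF} (h : LSSF a F) :
    SV a.length (revF a.length F) ∧ Shp a.length (anc (revF a.length F)) a ∧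
      LC (anc (revF a.length F)) := by
  obtain ⟨hne, hbase, hpos, hdisj, hrow, hA, hB, hfree⟩ := h
  have hBB : ∀ {v j}, 1 ≤ v → v ≤ a.length →
      (BBox a (a.length + 1 - v) j ↔ j ≤ shapeLen a v) := by
    intro v j h1 h2
    unfold BBox SBox
    rw [shapeLen_rev a h1 h2, List.length_reverse]
    omega
  have hrng : ∀ {i j}, BBox a i j → 1 ≤ i ∧ i ≤ a.length := by
    intro i j h
    unfold BBox SBox at h
    rw [List.length_reverse] at h
    omega
  have hanc : ∀ {i j}, 0 < anc F i j ↔ BBox a i j := by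
    intro i j
    exact ⟨fun h => (hne i j).1 ⟨_, anc_mem' h⟩,
      fun h => hpos i j _ (anc_mem ((hne i j).2 h))⟩
  have hdown : ∀ {i j}, BBox a i (j + 1) → BBox a i j := by
    intro i j h
    have hr := hrng h
    unfold BBox SBox at h ⊢
    omega
  have sv : SV a.length (revF a.length F) := by
    refine ⟨?_, ?_, ?_, ?_, ?_, ?_, ?_⟩
    · intro v j hv
      rw [← Finset.not_nonempty_iff_eq_empty]
      intro hc
      have := hrng ((hne _ _).1 hc)
      omega
    · intro v h1 h2
      show F (a.length + 1 - v) 0 = {v}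
      rw [hbase _ (by omega) (by omega)]
      congr 1; omega
    · intro v j e he; exact hpos _ _ _ he
    · intro j u v huv e h1 h2
      have r1 := hrng ((hne _ _).1 ⟨_, h1⟩)
      have r2 := hrng ((hne _ _).1 ⟨_, h2⟩)
      exact hdisj j _ _ (by omega) e h1 h2
    · intro v j e he
      rw [anc_revF]
      by_contra hc
      have hs := hanc.1 (show 0 < anc F (a.length + 1 - v) (j + 1) by omega)
      have := hrow _ j (hdown hs) hs
      have := infv_le (F := F) he
      omega
    · intro v j he
      rw [← Finset.not_nonempty_iff_eq_empty]
      intro hc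
      have := (hne _ _).2 (hdown ((hne _ _).1 hc))
      have he' : F (a.length + 1 - v) j = ∅ := he
      rw [he'] at this; simp at this
    · intro v j e he hea v' h1 h2
      rw [anc_revF] at hea h2 ⊢
      rw [anc_revF, anc_revF] at h1
      have he' : e ∈ F (a.length + 1 - v) j := he
      have bv := (hne _ _).1 ⟨_, he'⟩
      have rv := hrng bv
      rcases Nat.eq_zero_or_pos j with rfl | hj
      · exfalso
        apply hea
        have := hbase _ rv.1 rv.2
        rw [anc, this]
        rw [this, Finset.mem_singleton] at he'
        simpa using he'
      · by_contra hc
        have hs' := hanc.1 (show 0 < anc F (a.length + 1 - v') j by omega)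
        refine hfree _ j e bv hj he' hea _ hs' h1 h2 ⟨?_, Or.inr (by omega)⟩
        obtain ⟨k, rfl⟩ : ∃ k, j = k + 1 := ⟨j - 1, by omega⟩
        have := hrow _ k (hdown hs') hs'
        show e ≤ infv F (a.length + 1 - v') k
        omega
  have shp : Shp a.length (anc (revF a.length F)) a := by
    refine ⟨rfl, fun v h1 h2 j => ?_⟩
    rw [anc_revF, hanc, hBB h1 h2]
  refine ⟨sv, shp, ?_⟩
  intro u v j huv ⟨h1, h2, h3⟩
  have hf := sv.fil
  have hv := shp_zero hf shp h1
  have hu := shp_zero hf shp (lt_trans h1 h3)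
  simp only [anc_revF] at h1 h2 h3
  have hlt : a.length + 1 - v < a.length + 1 - u := by omega
  by_cases hc : shapeLen a u ≤ shapeLen a v
  · have key : ∀ i, i ≤ shapeLen a u →
        anc F (a.length + 1 - u) i < anc F (a.length + 1 - v) i := by
      intro i
      induction i with
      | zero =>
        intro _
        have b1 := hf.base u hu.1.1 hu.1.2
        have b2 := hf.base v hv.1.1 hv.1.2
        rw [anc_revF] at b1 b2
        omega
      | succ i ih =>
        intro hi
        have h5 := ih (by omega)
        have h6 := hf.anti u i
        rw [anc_revF, anc_revF] at h6
        have := hA _ _ i hlt ((hBB hv.1.1 hv.1.2).2 (by omega)) ((hBB hv.1.1 hv.1.2).2 (by omega))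
          ((hBB hu.1.1 hu.1.2).2 (by omega))
          (by rw [shapeLen_rev a hu.1.1 hu.1.2, shapeLen_rev a hv.1.1 hv.1.2]; exact hc)
        unfold InvTriple at this
        omega
    have := key j hu.2
    omega
  · have := hB _ _ j hlt ((hBB hu.1.1 hu.1.2).2 (by omega)) ((hBB hu.1.1 hu.1.2).2 (by omega))
      ((hBB hv.1.1 hv.1.2).2 (by omega))
      (by rw [shapeLen_rev a hu.1.1 hu.1.2, shapeLen_rev a hv.1.1 hv.1.2]; omega)
    unfold InvTriple at this
    omega

theorem lssf_of {a : List ℕ} {H : SVF} (sv : SV a.length H) (shp : Shp a.length (anc H) a)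
    (hl : LC (anc H)) : LSSF a (revF a.length H) := by
  have hf := sv.fil
  have hB : ∀ {i j}, BBox a i j ↔ 0 < anc H (a.length + 1 - i) j := by
    intro i j
    have e : ∀ (h1 : 1 ≤ i) (h2 : i ≤ a.length),
        shapeLen a.reverse i = shapeLen a (a.length + 1 - i) := by
      intro h1 h2
      rw [← shapeLen_rev a (v := a.length + 1 - i) (by omega) (by omega)]
      congr 1; omega
    constructor
    · intro h
      unfold BBox SBox at h
      rw [List.length_reverse] at h
      have h1 : 1 ≤ i ∧ i ≤ a.length := by omega
      rw [shp.2 _ (by omega) (by omega), ← e h1.1 h1.2]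
      omega
    · intro h
      have := shp_zero hf shp h
      unfold BBox SBox
      rw [List.length_reverse, e (by omega) (by omega)]
      omega
  have hrng : ∀ {i j}, BBox a i j → 1 ≤ i ∧ i ≤ a.length := by
    intro i j h
    unfold BBox SBox at h
    rw [List.length_reverse] at h
    omega
  have hne : ∀ i j, (revF a.length H i j).Nonempty ↔ BBox a i j := by
    intro i j
    rw [hB, sv.anc_pos]; rfl
  refine ⟨hne, ?_, ?_, ?_, ?_, ?_, ?_, ?_⟩
  · intro i h1 h2
    show H (a.length + 1 - i) 0 = _
    rw [sv.base _ (by omega) (by omega)]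
    congr 1; omega
  · intro i j v h; exact sv.pos _ _ _ h
  · intro j i i' hi v h1 h2
    have r1 := hrng ((hne _ _).1 ⟨_, h1⟩)
    have r2 := hrng ((hne _ _).1 ⟨_, h2⟩)
    exact sv.disj j _ _ (by omega) v h1 h2
  · intro i j h1 h2
    apply le_infv ((hne i j).2 h1)
    intro e he
    exact sv.row _ j e he
  · intro i i' j hi h1 h2 h3 hlen
    have r1 := hrng h2
    have r2 := hrng h3
    simp only [anc_revF]
    obtain ⟨v, hv, hv1, hv2⟩ : ∃ v, v = a.length + 1 - i ∧ 1 ≤ v ∧ v ≤ a.length :=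
      ⟨_, rfl, by omega, by omega⟩
    obtain ⟨u, hu, hu1, hu2⟩ : ∃ u, u = a.length + 1 - i' ∧ 1 ≤ u ∧ u ≤ a.length :=
      ⟨_, rfl, by omega, by omega⟩
    rw [show i = a.length + 1 - v by omega, show i' = a.length + 1 - u by omega,
      shapeLen_rev a hu1 hu2, shapeLen_rev a hv1 hv2] at hlen
    rw [hB, ← hv] at h1 h2
    rw [hB, ← hu] at h3
    rw [← hv, ← hu]
    have huv : u < v := by omega
    -- the shorter row stays strictly below the longer one
    have key : ∀ d k, k + d = shapeLen a u + 1 → 0 < anc H u k → anc H u k < anc H v k := by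
      intro d
      induction d with
      | zero =>
        intro k hk hp
        have := (shp.2 u hu1 hu2 k).1 hp
        omega
      | succ d ih =>
        intro k hk hp
        by_contra hc
        have e1 : k ≤ shapeLen a u := (shp.2 u hu1 hu2 k).1 hp
        have e2 := (shp.2 v hv1 hv2 k).2 (by omega)
        have a1 := hl u v k huv
        have a2 := hf.inj k u v (by omega) hp
        have a3 := hf.anti v k
        have a4 := ih (k + 1) (by omega)
        omega
    have a0 := key (shapeLen a u + 1 - (j + 1)) (j + 1)
      (by have := (shp.2 u hu1 hu2 (j + 1)).1 h3; omega) h3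
    have a1 := hf.anti v j
    unfold InvTriple
    omega
  · intro i i' j hi h1 h2 h3 hlen
    have r1 := hrng h2
    have r2 := hrng h3
    simp only [anc_revF]
    obtain ⟨v, hv, hv1, hv2⟩ : ∃ v, v = a.length + 1 - i ∧ 1 ≤ v ∧ v ≤ a.length :=
      ⟨_, rfl, by omega, by omega⟩
    obtain ⟨u, hu, hu1, hu2⟩ : ∃ u, u = a.length + 1 - i' ∧ 1 ≤ u ∧ u ≤ a.length :=
      ⟨_, rfl, by omega, by omega⟩
    rw [hB, ← hu] at h1 h2
    rw [hB, ← hv] at h3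
    rw [← hv, ← hu]
    have a1 := hl u v j (by omega)
    have a2 := hf.inj j u v (by omega) h1
    have a3 := hf.anti u j
    unfold InvTriple
    omega
  · intro i j e hs hj he hne' i' hs' h1 h2 hR
    have m := sv.minim _ j e he hne' _ h1 h2
    rcases hR.2 with h | h
    · apply h; rw [hB]; exact Nat.zero_lt_of_lt m
    · rw [anc_revF] at h; omega

theorem mem_skyline_s8 (b : List ℕ) (p : ℕ × ℕ) : p ∈ skyline b ↔ SBox b p.1 p.2 := by
  obtain ⟨i, j⟩ := p
  unfold skyline SBox shapeLen
  simp only [Finset.mem_biUnion, Finset.mem_range, Finset.mem_image, Prod.mk.injEq]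
  constructor
  · rintro ⟨i', h1, j', h2, rfl, rfl⟩
    simp only [Nat.add_sub_cancel]
    omega
  · rintro ⟨h1, h2, h3, h4⟩
    exact ⟨i - 1, by omega, j - 1, by omega, by omega, by omega⟩

open Classical in
noncomputable def colW (N : ℕ) (F : SVF) (v : ℕ) : ℕ :=
  ((Finset.Icc 1 N).filter fun j => ∃ i, v ∈ F i j).card

theorem wtF_eq {b : List ℕ} {F : SVF} (N : ℕ)
    (hne : ∀ i j, 1 ≤ j → ((F i j).Nonempty ↔ SBox b i j))
    (hdisj : ∀ j i i', i ≠ i' → ∀ v, v ∈ F i j → v ∉ F i' j)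
    (hN : ∀ i, shapeLen b i ≤ N) : wtF b F = colW N F := by
  classical
  funext v
  unfold wtF colW
  refine Finset.card_bij (fun p _ => p.2) ?_ ?_ ?_
  · intro p hp
    rw [Finset.mem_filter, mem_skyline_s8] at hp
    rw [Finset.mem_filter, Finset.mem_Icc]
    exact ⟨⟨hp.1.2.2.1, le_trans hp.1.2.2.2 (hN _)⟩, p.1, hp.2⟩
  · rintro ⟨i, j⟩ hp ⟨i', j'⟩ hq heq
    rw [Finset.mem_filter] at hp hq
    simp only at heq hp hq
    subst heq
    by_contra hc
    exact hdisj j i i' (by rintro rfl; exact hc rfl) v hp.2 hq.2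
  · intro j hj
    rw [Finset.mem_filter, Finset.mem_Icc] at hj
    obtain ⟨⟨h1, h2⟩, i, hi⟩ := hj
    refine ⟨(i, j), ?_, rfl⟩
    rw [Finset.mem_filter, mem_skyline_s8]
    exact ⟨(hne i j h1).1 ⟨_, hi⟩, hi⟩

theorem sizeF_eq {b : List ℕ} {F : SVF} (n : ℕ) (hle : ∀ i j, 1 ≤ j → ∀ e ∈ F i j, e ≤ n) :
    sizeF b F = ∑ v ∈ Finset.range (n + 1), wtF b F v := by
  unfold sizeF wtF
  simp only [Finset.card_filter]
  rw [Finset.sum_comm]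
  refine Finset.sum_congr rfl fun p hp => ?_
  rw [← Finset.card_filter]
  congr 1
  ext e
  rw [Finset.mem_filter, Finset.mem_range]
  rw [mem_skyline_s8] at hp
  exact ⟨fun h => ⟨by have := hle _ _ hp.2.2.1 e h; omega, h⟩, fun h => h.2⟩

noncomputable def colT (n N : ℕ) (F : SVF) : MvPolynomial ℕ (Polynomial ℤ) :=
  MvPolynomial.C (Polynomial.X ^ ((∑ v ∈ Finset.range (n + 1), colW N F v) - N)) *
    vmono (colW N F)

theorem SV.le_n {n : ℕ} {H : SVF} (h : SV n H) {v j e : ℕ} (he : e ∈ H v j) : e ≤ n := by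
  have h1 := le_anc he
  have h2 : 0 < anc H v j := h.anc_pos.2 ⟨_, he⟩
  by_cases hv : 1 ≤ v ∧ v ≤ n
  · have := h.fil.le v j
    omega
  · rw [h.out v j hv] at he; simp at he

theorem lswap_len {a b : List ℕ} (h : Relation.ReflTransGen LSwapStep a b) :
    b.length = a.length := (lswap_perm h).length_eq

theorem lassf_le {b : List ℕ} {F : SVF} (h : LASSF b F) {i j e : ℕ} (hj : 1 ≤ j)
    (he : e ∈ F i j) : e ≤ b.length := by
  apply (lassf_to h).1.le_n (v := i) (j := j)
  rw [extF_pos _ _ _ hj]; exact he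

theorem lassf_T {a b : List ℕ} (hab : Relation.ReflTransGen LSwapStep a b) {F : SVF}
    (h : LASSF b F) :
    MvPolynomial.C (Polynomial.X ^ (sizeF b F - b.sum)) * vmono (wtF b F) =
      colT a.length a.sum F := by
  have hs : b.sum = a.sum := (lswap_perm hab).sum_eq
  unfold colT
  rw [sizeF_eq a.length (fun i j hj e he => lswap_len hab ▸ lassf_le h hj he),
    wtF_eq a.sum (fun i j _ => h.1.1 i j) h.1.2.2.1 (fun i => hs ▸ shapeLen_le b i), hs]

theorem lssf_T {a : List ℕ} {F : SVF} (h : LSSF a F) :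
    MvPolynomial.C (Polynomial.X ^ (sizeF a.reverse F - a.sum)) * vmono (wtF a.reverse F) =
      colT a.length a.sum F := by
  have hs : a.reverse.sum = a.sum := List.sum_reverse a
  have hr := lssf_to h
  unfold colT
  have hne : ∀ i j, 1 ≤ j → ((F i j).Nonempty ↔ SBox a.reverse i j) := by
    intro i j hj
    rw [h.1 i j]
    unfold BBox
    exact ⟨fun h => h.resolve_left (by omega), Or.inr⟩
  have hle : ∀ i j, 1 ≤ j → ∀ e ∈ F i j, e ≤ a.length := by
    intro i j hj e he
    have hb := (hne i j hj).1 ⟨e, he⟩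
    have h1 := hb.1
    have h2 := hb.2.1
    rw [List.length_reverse] at h2
    apply hr.1.le_n (v := a.length + 1 - i) (j := j)
    unfold revF
    rw [show a.length + 1 - (a.length + 1 - i) = i by omega]
    exact he
  rw [sizeF_eq a.length hle,
    wtF_eq a.sum hne h.2.2.2.1 (fun i => hs ▸ shapeLen_le a.reverse i)]

theorem lassf_finite (b : List ℕ) : {F : SVF | LASSF b F}.Finite := by
  refine Set.Finite.of_injOn
    (f := fun F : SVF => (skyline b ×ˢ Finset.range (b.length + 1)).filter
      fun p => p.2 ∈ F p.1.1 p.1.2)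
    (t := ((skyline b ×ˢ Finset.range (b.length + 1)).powerset : Set (Finset ((ℕ × ℕ) × ℕ))))
    ?_ ?_ (Finset.finite_toSet _)
  · intro F _
    simp only [Finset.coe_powerset, Set.mem_preimage, Set.mem_powerset_iff, Finset.coe_subset]
    exact Finset.filter_subset _ _
  · have sub : ∀ F G : SVF, LASSF b F →
        ((skyline b ×ˢ Finset.range (b.length + 1)).filter fun p => p.2 ∈ F p.1.1 p.1.2) =
        ((skyline b ×ˢ Finset.range (b.length + 1)).filter fun p => p.2 ∈ G p.1.1 p.1.2) →
        ∀ i j e, e ∈ F i j → e ∈ G i j := by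
      intro F G hF heq i j e he
      have hb := (hF.1.1 i j).1 ⟨_, he⟩
      have hm : ((i, j), e) ∈ (skyline b ×ˢ Finset.range (b.length + 1)).filter
          fun p => p.2 ∈ F p.1.1 p.1.2 := by
        rw [Finset.mem_filter, Finset.mem_product, mem_skyline_s8, Finset.mem_range]
        exact ⟨⟨hb, by have := lassf_le hF hb.2.2.1 he; simp only; omega⟩, he⟩
      rw [heq, Finset.mem_filter] at hm
      exact hm.2
    intro F hF G hG heq
    funext i j
    ext e
    exact ⟨sub F G hF heq i j e, sub G F hG heq.symm i j e⟩

theorem finsum_rel {α β M : Type*} [AddCommMonoid M] {s : Set α} {t : Set β} (R : α → β → Prop)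
    (f : α → M) (g : β → M)
    (h1 : ∀ x ∈ s, ∃ y ∈ t, R x y) (h2 : ∀ y ∈ t, ∃ x ∈ s, R x y)
    (u1 : ∀ x ∈ s, ∀ y ∈ t, ∀ y' ∈ t, R x y → R x y' → y = y')
    (u2 : ∀ x ∈ s, ∀ x' ∈ s, ∀ y ∈ t, R x y → R x' y → x = x')
    (hfg : ∀ x ∈ s, ∀ y ∈ t, R x y → f x = g y) : ∑ᶠ x ∈ s, f x = ∑ᶠ y ∈ t, g y := by
  classical
  rcases t.eq_empty_or_nonempty with rfl | ⟨y0, hy0⟩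
  · have : s = ∅ := by
      rw [Set.eq_empty_iff_forall_notMem]
      intro x hx
      obtain ⟨y, hy, _⟩ := h1 x hx
      exact hy
    subst this
    simp
  · have : ∀ x, ∃ y, x ∈ s → (y ∈ t ∧ R x y) := by
      intro x
      by_cases hx : x ∈ s
      · obtain ⟨y, hy, hR⟩ := h1 x hx
        exact ⟨y, fun _ => ⟨hy, hR⟩⟩
      · exact ⟨y0, fun h => absurd h hx⟩
    choose e he using this
    refine finsum_mem_eq_of_bijOn e ⟨fun x hx => (he x hx).1, ?_, ?_⟩
      fun x hx => hfg x hx _ (he x hx).1 (he x hx).2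
    · intro x hx x' hx' heq
      exact u2 x hx x' hx' (e x) (he x hx).1 (he x hx).2 (heq ▸ (he x' hx').2)
    · intro y hy
      obtain ⟨x, hx, hR⟩ := h2 y hy
      exact ⟨x, hx, u1 x hx _ (he x hx).1 y hy (he x hx).2 hR⟩

theorem shape_inj {b c : List ℕ} (hl : b.length = c.length) {F : SVF} (hb : LASSF b F)
    (hc : LASSF c F) : b = c := by
  have key : ∀ {b c : List ℕ}, b.length = c.length → LASSF b F → LASSF c F → ∀ i < b.length,
      b.getD i 0 ≤ c.getD i 0 := by
    intro b c hl hb hc i hi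
    by_contra hlt
    have h1 : SBox b (i + 1) (b.getD i 0) :=
      ⟨by omega, by omega, by omega, le_of_eq (by simp [shapeLen])⟩
    have h2 := ((hb.1.1 _ _).trans (Iff.rfl)).2 h1
    have h3 := ((hc.1.1 _ _).1 h2).2.2.2
    simp only [shapeLen, Nat.add_sub_cancel] at h3
    omega
  apply List.ext_getElem hl
  intro i h1 h2
  have e1 := key hl hb hc i h1
  have e2 := key hl.symm hc hb i h2
  rw [List.getD_eq_getElem _ _ h1, List.getD_eq_getElem _ _ h2] at e1
  rw [List.getD_eq_getElem _ _ h1, List.getD_eq_getElem _ _ h2] at e2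
  omega

theorem atoms_sum (a : List ℕ) :
    ∑ᶠ b ∈ {b : List ℕ | Relation.ReflTransGen LSwapStep a b}, atomPoly b =
      ∑ᶠ F ∈ ⋃ b ∈ {b : List ℕ | Relation.ReflTransGen LSwapStep a b}, {F : SVF | LASSF b F},
        colT a.length a.sum F := by
  rw [finsum_mem_biUnion]
  · refine finsum_mem_congr rfl fun b hb => ?_
    unfold atomPoly
    exact finsum_mem_congr rfl fun F hF => lassf_T hb hF
  · intro b hb c hc hne
    rw [Function.onFun, Set.disjoint_left]
    intro F h1 h2
    exact hne (shape_inj ((lswap_len hb).trans (lswap_len hc).symm) h1 h2)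
  · refine Set.Finite.subset (List.finite_toSet a.permutations) ?_
    intro b hb
    exact List.mem_permutations.2 (lswap_perm hb)
  · intro b _; exact lassf_finite b

theorem lssf_out {a : List ℕ} {F : SVF} (h : LSSF a F) :
    ∀ v j, ¬ (1 ≤ v ∧ v ≤ a.length) → F v j = ∅ := by
  intro v j hv
  rw [← Finset.not_nonempty_iff_eq_empty, h.1 v j]
  unfold BBox SBox
  rw [List.length_reverse]
  omega

theorem extF_unextF {n : ℕ} {K : SVF} (h : SV n K) : extF n (unextF K) = K := by
  funext v j
  unfold extF unextF
  split_ifs with c1 c2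
  · subst c1; rw [h.base v c2.1 c2.2]
  · rw [h.out v j c2]
  · rfl

theorem extF_inj {n : ℕ} {b c : List ℕ} {F G : SVF} (hF : LASSF b F) (hG : LASSF c G)
    (h : extF n F = extF n G) : F = G := by
  funext v j
  rcases Nat.eq_zero_or_pos j with rfl | hj
  · have e1 : F v 0 = ∅ := by
      rw [← Finset.not_nonempty_iff_eq_empty, hF.1.1 v 0]; rintro ⟨_, _, h, _⟩; omega
    have e2 : G v 0 = ∅ := by
      rw [← Finset.not_nonempty_iff_eq_empty, hG.1.1 v 0]; rintro ⟨_, _, h, _⟩; omega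
    rw [e1, e2]
  · rw [← extF_pos n F v hj, h, extF_pos n G v hj]

theorem CS.symm {H K : SVF} (h : CS H K) : CS K H := fun j e => (h j e).symm
theorem CS.trans {H K L : SVF} (h : CS H K) (h' : CS K L) : CS H L :=
  fun j e => (h j e).trans (h' j e)

theorem colW_eq {n : ℕ} (N : ℕ) {F G : SVF} (hF : ∀ v j, ¬ (1 ≤ v ∧ v ≤ n) → F v j = ∅)
    (h : CS (revF n F) (extF n G)) : colW N F = colW N G := by
  classical
  funext e
  unfold colW
  congr 1
  apply Finset.filter_congr
  intro j hj
  rw [Finset.mem_Icc] at hj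
  have h1 := h j e
  simp only [extF_pos n G _ hj.1] at h1
  rw [← h1]
  constructor
  · rintro ⟨i, hi⟩
    have hr : 1 ≤ i ∧ i ≤ n := by
      by_contra hc
      rw [hF i j hc] at hi; simp at hi
    refine ⟨n + 1 - i, ?_⟩
    unfold revF
    rw [show n + 1 - (n + 1 - i) = i by omega]
    exact hi
  · rintro ⟨i, hi⟩
    exact ⟨_, hi⟩

theorem stmt8 (a : List ℕ) :
    lascouxPoly a =
      ∑ᶠ b ∈ {b : List ℕ | Relation.ReflTransGen LSwapStep a b}, atomPoly b := by
  rw [atoms_sum]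
  unfold lascouxPoly
  have hU : ∀ G, G ∈ (⋃ b ∈ {b : List ℕ | Relation.ReflTransGen LSwapStep a b},
      {F : SVF | LASSF b F}) ↔ ∃ b, Relation.ReflTransGen LSwapStep a b ∧ LASSF b G := by
    intro G; simp
  have hto : ∀ {b G}, Relation.ReflTransGen LSwapStep a b → LASSF b G →
      SV a.length (extF a.length G) ∧ Shp a.length (anc (extF a.length G)) b ∧
      AtC (anc (extF a.length G)) := by
    intro b G hb hG
    have := lassf_to hG
    rwa [lswap_len hb] at this
  apply finsum_rel (fun F G => Col (anc (revF a.length F)) (anc (extF a.length G)) ∧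
    CS (revF a.length F) (extF a.length G))
  · intro F hF
    obtain ⟨sv, shp, lc⟩ := lssf_to hF
    obtain ⟨g, b, hb, fg, sg, cg, ag⟩ := gamma _ rfl sv.fil shp rfl
    obtain ⟨K, hK, rfl, cs⟩ := SV_exists sv fg cg
    refine ⟨unextF K, (hU _).2 ⟨b, hb, ?_⟩, ?_⟩
    · have hl := lswap_len hb
      exact lassf_of (hl.symm ▸ hK) (hl.symm ▸ sg) ag
    · rw [extF_unextF hK]; exact ⟨cg, cs⟩
  · intro G hG
    obtain ⟨b, hb, hG⟩ := (hU _).1 hG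
    obtain ⟨sv, shp, at'⟩ := hto hb hG
    obtain ⟨g, fg, sg, cg⟩ := beta hb sv.fil shp
    obtain ⟨g', fg', sg', cg', lg'⟩ := alpha _ fg sg rfl
    have cc := cg.trans cg'
    obtain ⟨K, hK, rfl, cs⟩ := SV_exists sv fg' cc
    refine ⟨revF a.length K, lssf_of hK sg' lg', ?_⟩
    rw [revF_revF hK.out]
    exact ⟨cc.symm, cs.symm⟩
  · intro F _ G hG G' hG' h h'
    obtain ⟨b, hb, hG⟩ := (hU _).1 hG
    obtain ⟨b', hb', hG'⟩ := (hU _).1 hG'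
    obtain ⟨sv, shp, at1⟩ := hto hb hG
    obtain ⟨sv', shp', at2⟩ := hto hb' hG'
    exact extF_inj hG hG' (SV_unique sv sv'
      (AtC_unique sv.fil sv'.fil (h.1.symm.trans h'.1) at1 at2) (h.2.symm.trans h'.2))
  · intro F hF F' hF' G _ h h'
    obtain ⟨sv, shp, l1⟩ := lssf_to hF
    obtain ⟨sv', shp', l2⟩ := lssf_to hF'
    have := SV_unique sv sv'
      (LC_unique sv.fil sv'.fil shp shp' (h.1.trans h'.1.symm) l1 l2) (h.2.trans h'.2.symm)
    rw [← revF_revF (lssf_out hF), this, revF_revF (lssf_out hF')]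
  · intro F hF G _ h
    rw [lssf_T hF]
    unfold colT
    rw [colW_eq a.sum (lssf_out hF) h.2]
end
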